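/- arXiv:1109.1455 — 3 statements merged into one kernel-verified Lean document; each statement's English description precedes it below -/
import Mathlib

section
/- Let r ≥ 2 be an integer. Let 𝒰 and 𝒱 be disjoint nonempty finite sets of primes p with p ≡ 1 (mod r), and set U = #𝒰, V = #𝒱, A = UV. For each prime p ∈ 𝒰 ∪ 𝒱 let χ_p be a complex-valued Dirichlet character modulo p such that χ_p(m^r) = 1 whenever p ∤ m, and for a product q of distinct primes from 𝒰 ∪ 𝒱 set χ_q(n) = ∏_{p | q} χ_p(n). Let ω : ℤ → [0,∞) be a function with ω(n) = 0 whenever |n| ≥ exp(min(U,V)). Assume that V³ ≤ A and that min(U,V)·(U+V) ≤ (r·log 2/4)·A. Then there is an absolute constant C such that Σ_{n ∈ ℤ, n ≠ 0} ω(n^r) ≤ C·[ A^{−1} Σ_{n ∈ ℤ} ω(n) + A^{−2} Σ_{v,v' ∈ 𝒱} Σ_{u ≠ u' ∈ 𝒰} | Σ_{n ∈ ℤ} ω(n) χ_{uv}(n) conj(χ_{u'v'}(n)) | + U·A^{−2} Σ_{v ≠ v' ∈ 𝒱} | Σ_{n ∈ ℤ} ω(n) χ_v(n) conj(χ_{v'}(n))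 | ]. -/
lemma card_filter_dvd_mul_log_two_le (P : Finset ℕ) (hP : ∀ p ∈ P, p.Prime) {n : ℤ} (hn : n ≠ 0) :
    ((P.filter fun p : ℕ => (p : ℤ) ∣ n).card : ℝ) * Real.log 2 ≤ Real.log |(n : ℝ)| := by
  set Q := P.filter fun p : ℕ => (p : ℤ) ∣ n with hQ
  have hQP : ∀ p ∈ Q, p.Prime := fun p hp => hP p (Finset.mem_filter.1 hp).1
  have hdvd : ∏ p ∈ Q, p ∣ n.natAbs :=
    Finset.prod_primes_dvd _ (fun p hp => (hQP p hp).prime) fun p hp =>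
      Int.natCast_dvd.1 (Finset.mem_filter.1 hp).2
  have hle : 2 ^ Q.card ≤ n.natAbs :=
    (Finset.pow_card_le_prod Q (fun p => p) 2 fun p hp => (hQP p hp).two_le).trans
      (Nat.le_of_dvd (Int.natAbs_pos.2 hn) hdvd)
  have hle' : (2 : ℝ) ^ Q.card ≤ |(n : ℝ)| := by
    rw [← Int.cast_abs, Int.abs_eq_natAbs]
    exact_mod_cast hle
  rw [← Real.log_pow]
  exact Real.log_le_log (by positivity) hle'

lemma card_sub_card_filter_dvd_le_sum_norm_sq (P : Finset ℕ) (hP : ∀ p ∈ P, p.Prime)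
    (χ : (p : ℕ) → DirichletCharacter ℂ p) (n : ℤ) :
    (P.card : ℝ) - (P.filter fun p : ℕ => (p : ℤ) ∣ n).card ≤
      ∑ p ∈ P, ‖χ p (n : ZMod p)‖ ^ 2 := by
  have hcard : (P.card : ℝ) - (P.filter fun p : ℕ => (p : ℤ) ∣ n).card =
      ∑ p ∈ P, (1 - if (p : ℤ) ∣ n then (1 : ℝ) else 0) := by
    simp [Finset.sum_sub_distrib]
  rw [hcard]
  refine Finset.sum_le_sum fun p hp => ?_
  split_ifs with h
  · simp
  · have : Fact p.Prime := ⟨hP p hp⟩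
    have hu : IsUnit (n : ZMod p) :=
      isUnit_iff_ne_zero.2 fun h0 => h ((ZMod.intCast_zmod_eq_zero_iff_dvd n p).1 h0)
    have := (χ p).unit_norm_eq_one hu.unit
    rw [IsUnit.unit_spec] at this
    simp [this]

lemma sum_norm_sq_le_card (P : Finset ℕ) (χ : (p : ℕ) → DirichletCharacter ℂ p) (n : ℤ) :
    ∑ p ∈ P, ‖χ p (n : ZMod p)‖ ^ 2 ≤ P.card := by
  simpa using Finset.sum_le_card_nsmul P (fun p => ‖χ p (n : ZMod p)‖ ^ 2) 1
    fun p _ => pow_le_one₀ (norm_nonneg _) ((χ p).norm_le_one _)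

lemma sum_eq_card_sub_of_eq_pow (P : Finset ℕ) (hP : ∀ p ∈ P, p.Prime)
    (χ : (p : ℕ) → DirichletCharacter ℂ p) {r : ℕ} (hr : r ≠ 0)
    (hχ : ∀ p ∈ P, ∀ m : ℤ, ¬ ((p : ℤ) ∣ m) → χ p ((m : ZMod p) ^ r) = 1) (m : ℤ) :
    ∑ p ∈ P, χ p ((m ^ r : ℤ) : ZMod p) =
      (((P.card : ℝ) - (P.filter fun p : ℕ => (p : ℤ) ∣ m).card : ℝ) : ℂ) := by
  have hcard : (((P.card : ℝ) - (P.filter fun p : ℕ => (p : ℤ) ∣ m).card : ℝ) : ℂ) =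
      ∑ p ∈ P, (1 - if (p : ℤ) ∣ m then (1 : ℂ) else 0) := by
    simp [Finset.sum_sub_distrib]
  rw [hcard]
  refine Finset.sum_congr rfl fun p hp => ?_
  have : Fact p.Prime := ⟨hP p hp⟩
  split_ifs with h
  · have h0 : (m : ZMod p) = 0 := (ZMod.intCast_zmod_eq_zero_iff_dvd m p).2 h
    rw [Int.cast_pow, h0, zero_pow hr, MulChar.map_zero, sub_self]
  · rw [Int.cast_pow, hχ p hp m h, sub_zero]

lemma sum_comp_pow_le_two_mul_sum {r : ℕ} (hr : r ≠ 0) (M F : Finset ℤ) (hM : ∀ m ∈ M, m ^ r ∈ F)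
    (G : ℤ → ℝ) (hG : ∀ n, 0 ≤ G n) :
    ∑ m ∈ M, G (m ^ r) ≤ 2 * ∑ n ∈ F, G n := by
  have habs : ∀ {a b : ℤ}, a ^ r = b ^ r → |a| = |b| := fun {a b} h =>
    (pow_left_inj₀ (abs_nonneg a) (abs_nonneg b) hr).1 (by rw [← abs_pow, ← abs_pow, h])
  have key : ∀ M' ⊆ M, Set.InjOn (fun m : ℤ => m ^ r) M' →
      ∑ m ∈ M', G (m ^ r) ≤ ∑ n ∈ F, G n := fun M' hM' hinj => by
    rw [← Finset.sum_image (f := G) hinj]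
    exact Finset.sum_le_sum_of_subset_of_nonneg
      (Finset.image_subset_iff.2 fun m hm => hM m (hM' hm)) fun n _ _ => hG n
  rw [← Finset.sum_filter_add_sum_filter_not M (fun m => 0 < m), two_mul]
  refine add_le_add (key _ (Finset.filter_subset _ _) ?_) (key _ (Finset.filter_subset _ _) ?_)
  · intro a ha b hb h
    have ha' := (Finset.mem_filter.1 (Finset.mem_coe.1 ha)).2
    have hb' := (Finset.mem_filter.1 (Finset.mem_coe.1 hb)).2
    have := habs h
    rwa [abs_of_pos ha', abs_of_pos hb'] at this
  · intro a ha b hb h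
    have ha' := (Finset.mem_filter.1 (Finset.mem_coe.1 ha)).2
    have hb' := (Finset.mem_filter.1 (Finset.mem_coe.1 hb)).2
    have := habs h
    rw [abs_of_nonpos (not_lt.1 ha'), abs_of_nonpos (not_lt.1 hb')] at this
    exact neg_injective this

lemma norm_sum_mul_sum_sq_eq (P Q : Finset ℕ) (f g : ℕ → ℂ) :
    ((‖(∑ u ∈ P, f u) * ∑ v ∈ Q, g v‖ ^ 2 : ℝ) : ℂ) =
      ∑ v ∈ Q, ∑ v' ∈ Q, ∑ u ∈ P, ∑ u' ∈ P \ {u},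
          (f u * g v) * (starRingEnd ℂ) (f u' * g v') +
        ((∑ u ∈ P, ‖f u‖ ^ 2 : ℝ) : ℂ) *
          ∑ v ∈ Q, ∑ v' ∈ Q \ {v}, g v * (starRingEnd ℂ) (g v') +
        ((∑ u ∈ P, ‖f u‖ ^ 2 : ℝ) : ℂ) * ((∑ v ∈ Q, ‖g v‖ ^ 2 : ℝ) : ℂ) := by
  have diag : ∀ (R : Finset ℕ) (h : ℕ → ℂ),
      (∑ x ∈ R, h x) * (starRingEnd ℂ) (∑ x ∈ R, h x) =
        ∑ x ∈ R, ∑ x' ∈ R \ {x}, h x * (starRingEnd ℂ) (h x') +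
          ((∑ x ∈ R, ‖h x‖ ^ 2 : ℝ) : ℂ) := fun R h => by
    rw [map_sum, Finset.sum_mul_sum, Complex.ofReal_sum, ← Finset.sum_add_distrib]
    refine Finset.sum_congr rfl fun x hx => ?_
    rw [← Finset.sum_sdiff (Finset.singleton_subset_iff.2 hx), Finset.sum_singleton,
      Complex.mul_conj']
    push_cast
    rfl
  have hoff : ∑ v ∈ Q, ∑ v' ∈ Q, ∑ u ∈ P, ∑ u' ∈ P \ {u},
        (f u * g v) * (starRingEnd ℂ) (f u' * g v') =
      (∑ u ∈ P, ∑ u' ∈ P \ {u}, f u * (starRingEnd ℂ) (f u')) *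
        ((∑ v ∈ Q, g v) * (starRingEnd ℂ) (∑ v ∈ Q, g v)) := by
    rw [map_sum, Finset.sum_mul_sum, Finset.mul_sum]
    refine Finset.sum_congr rfl fun v _ => ?_
    rw [Finset.mul_sum]
    refine Finset.sum_congr rfl fun v' _ => ?_
    rw [Finset.sum_mul]
    refine Finset.sum_congr rfl fun u _ => ?_
    rw [Finset.sum_mul]
    refine Finset.sum_congr rfl fun u' _ => ?_
    rw [map_mul]
    ring
  rw [hoff, Complex.ofReal_pow, ← Complex.mul_conj', map_mul, mul_mul_mul_comm, diag P f]
  conv_lhs => rw [add_mul]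
  rw [add_assoc, ← mul_add, ← diag Q g]

lemma norm_sum_sum_sdiff_le (Q : Finset ℕ) (g : ℕ → ℂ) (hg : ∀ v ∈ Q, ‖g v‖ ≤ 1) :
    ‖∑ v ∈ Q, ∑ v' ∈ Q \ {v}, g v * (starRingEnd ℂ) (g v')‖ ≤ (Q.card : ℝ) ^ 2 := by
  rw [pow_two, ← nsmul_eq_mul]
  refine norm_sum_le_of_le _ (f := fun v => ∑ v' ∈ Q \ {v}, g v * (starRingEnd ℂ) (g v'))
    (n := fun _ => (Q.card : ℝ)) (fun v hv => ?_) |>.trans (by simp)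
  refine (norm_sum_le_of_le _ (n := fun _ => (1 : ℝ)) fun v' hv' => ?_).trans ?_
  · rw [norm_mul, RCLike.norm_conj]
    exact mul_le_one₀ (hg v hv) (norm_nonneg _) (hg v' (Finset.mem_sdiff.1 hv').1)
  · simpa using Finset.card_le_card (Finset.sdiff_subset (s := Q) (t := {v}))

/-- The large sieve expansion: the second moment of `(∑ χ_u) (∑ χ_v)` is bounded by its diagonal
and off-diagonal contributions. -/
lemma sum_weight_mul_norm_sq_le (𝒰 𝒱 : Finset ℕ) (h𝒰 : ∀ p ∈ 𝒰, p.Prime)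
    (h𝒱 : ∀ p ∈ 𝒱, p.Prime) (χ : (p : ℕ) → DirichletCharacter ℂ p) (ω : ℤ → ℝ)
    (hω : ∀ n, 0 ≤ ω n)
    (hsupp : ∀ n : ℤ, Real.exp (𝒱.card : ℝ) ≤ |(n : ℝ)| → ω n = 0)
    (hV : (𝒱.card : ℝ) ^ 3 ≤ (𝒰.card : ℝ) * 𝒱.card) (F : Finset ℤ) :
    ∑ n ∈ F, ω n * ‖(∑ u ∈ 𝒰, χ u (n : ZMod u)) * ∑ v ∈ 𝒱, χ v (n : ZMod v)‖ ^ 2 ≤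
      ∑ v ∈ 𝒱, ∑ v' ∈ 𝒱, ∑ u ∈ 𝒰, ∑ u' ∈ 𝒰 \ {u},
          ‖∑ n ∈ F, (ω n : ℂ) * (χ u (n : ZMod u) * χ v (n : ZMod v)) *
            (starRingEnd ℂ) (χ u' (n : ZMod u') * χ v' (n : ZMod v'))‖ +
        (𝒰.card : ℝ) * ∑ v ∈ 𝒱, ∑ v' ∈ 𝒱 \ {v},
          ‖∑ n ∈ F, (ω n : ℂ) * χ v (n : ZMod v) * (starRingEnd ℂ) (χ v' (n : ZMod v'))‖ +
        3 * ((𝒰.card : ℝ) * 𝒱.card) * ∑ n ∈ F, ω n := by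
  set E₁ : ℤ → ℂ := fun n => ∑ v ∈ 𝒱, ∑ v' ∈ 𝒱, ∑ u ∈ 𝒰, ∑ u' ∈ 𝒰 \ {u},
    (χ u (n : ZMod u) * χ v (n : ZMod v)) *
      (starRingEnd ℂ) (χ u' (n : ZMod u') * χ v' (n : ZMod v')) with hE₁
  set E₂ : ℤ → ℂ := fun n => ∑ v ∈ 𝒱, ∑ v' ∈ 𝒱 \ {v},
    χ v (n : ZMod v) * (starRingEnd ℂ) (χ v' (n : ZMod v')) with hE₂
  have pointwise : ∀ n : ℤ,
      ω n * ‖(∑ u ∈ 𝒰, χ u (n : ZMod u)) * ∑ v ∈ 𝒱, χ v (n : ZMod v)‖ ^ 2 ≤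
        ((ω n : ℂ) * E₁ n).re + 𝒰.card * ((ω n : ℂ) * E₂ n).re +
          3 * ((𝒰.card : ℝ) * 𝒱.card) * ω n := by
    intro n
    set s := ∑ u ∈ 𝒰, ‖χ u (n : ZMod u)‖ ^ 2 with hs
    set t := ∑ v ∈ 𝒱, ‖χ v (n : ZMod v)‖ ^ 2 with ht
    have hs1 : s ≤ 𝒰.card := sum_norm_sq_le_card 𝒰 χ n
    have ht1 : t ≤ 𝒱.card := sum_norm_sq_le_card 𝒱 χ n
    have ht0 : 0 ≤ t := Finset.sum_nonneg fun _ _ => sq_nonneg _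
    have hid := congrArg Complex.re (norm_sum_mul_sum_sq_eq 𝒰 𝒱
      (fun u => χ u (n : ZMod u)) (fun v => χ v (n : ZMod v)))
    rw [Complex.ofReal_re, Complex.add_re, Complex.add_re, Complex.re_ofReal_mul,
      Complex.re_ofReal_mul, Complex.ofReal_re] at hid
    change _ = (E₁ n).re + s * (E₂ n).re + s * t at hid
    rw [hid, Complex.re_ofReal_mul, Complex.re_ofReal_mul]
    rcases (hω n).eq_or_lt with h0 | hpos
    · simp [← h0]
    have herr : -(𝒰.card - s) * (E₂ n).re ≤ 2 * ((𝒰.card : ℝ) * 𝒱.card) := by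
      rcases eq_or_ne n 0 with rfl | hn
      · have : E₂ 0 = 0 := by
          refine Finset.sum_eq_zero fun v hv => Finset.sum_eq_zero fun v' _ => ?_
          have : Fact v.Prime := ⟨h𝒱 v hv⟩
          rw [Int.cast_zero, MulChar.map_zero, zero_mul]
        rw [this, Complex.zero_re, mul_zero]
        positivity
      have hlt : |(n : ℝ)| < Real.exp 𝒱.card := by
        by_contra! h
        exact hpos.ne' (hsupp n h)
      have hlog : Real.log |(n : ℝ)| ≤ 𝒱.card :=
        (Real.log_le_iff_le_exp (by positivity)).2 hlt.le
      have hcount := (card_filter_dvd_mul_log_two_le 𝒰 h𝒰 hn).trans hlog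
      have hlow := card_sub_card_filter_dvd_le_sum_norm_sq 𝒰 h𝒰 χ n
      have hd : 𝒰.card - s ≤ 2 * 𝒱.card := by
        have := Real.log_two_gt_d9
        have hc : (0 : ℝ) ≤ (𝒰.filter fun p : ℕ => (p : ℤ) ∣ n).card := Nat.cast_nonneg _
        nlinarith
      have hE : |(E₂ n).re| ≤ (𝒱.card : ℝ) ^ 2 :=
        (Complex.abs_re_le_norm _).trans
          (norm_sum_sum_sdiff_le 𝒱 _ fun v _ => (χ v).norm_le_one _)
      calc -(𝒰.card - s) * (E₂ n).re = (𝒰.card - s) * (-(E₂ n).re) := by ring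
        _ ≤ (𝒰.card - s) * (𝒱.card : ℝ) ^ 2 :=
          mul_le_mul_of_nonneg_left ((neg_le_abs _).trans hE) (sub_nonneg.2 hs1)
        _ ≤ 2 * 𝒱.card * (𝒱.card : ℝ) ^ 2 := by gcongr
        _ = 2 * (𝒱.card : ℝ) ^ 3 := by ring
        _ ≤ 2 * ((𝒰.card : ℝ) * 𝒱.card) := by gcongr
    have hst : s * t ≤ (𝒰.card : ℝ) * 𝒱.card := by gcongr
    have hsum : (E₁ n).re + s * (E₂ n).re + s * t ≤
        (E₁ n).re + 𝒰.card * (E₂ n).re + 3 * ((𝒰.card : ℝ) * 𝒱.card) := by linarith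
    calc _ ≤ ω n * ((E₁ n).re + 𝒰.card * (E₂ n).re + 3 * ((𝒰.card : ℝ) * 𝒱.card)) := by gcongr
      _ = _ := by ring
  have hsum₁ : ∑ n ∈ F, (ω n : ℂ) * E₁ n = ∑ v ∈ 𝒱, ∑ v' ∈ 𝒱, ∑ u ∈ 𝒰, ∑ u' ∈ 𝒰 \ {u},
      ∑ n ∈ F, (ω n : ℂ) * (χ u (n : ZMod u) * χ v (n : ZMod v)) *
            (starRingEnd ℂ) (χ u' (n : ZMod u') * χ v' (n : ZMod v')) := by
    simp only [hE₁, Finset.mul_sum, mul_assoc]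
    rw [Finset.sum_comm]
    refine Finset.sum_congr rfl fun v _ => ?_
    rw [Finset.sum_comm]
    refine Finset.sum_congr rfl fun v' _ => ?_
    rw [Finset.sum_comm]
    refine Finset.sum_congr rfl fun u _ => ?_
    rw [Finset.sum_comm]
  have hsum₂ : ∑ n ∈ F, (ω n : ℂ) * E₂ n = ∑ v ∈ 𝒱, ∑ v' ∈ 𝒱 \ {v},
      ∑ n ∈ F, (ω n : ℂ) * χ v (n : ZMod v) * (starRingEnd ℂ) (χ v' (n : ZMod v')) := by
    simp only [hE₂, Finset.mul_sum, mul_assoc]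
    rw [Finset.sum_comm]
    refine Finset.sum_congr rfl fun v _ => ?_
    rw [Finset.sum_comm]
  refine (Finset.sum_le_sum fun n _ => pointwise n).trans ?_
  rw [Finset.sum_add_distrib, Finset.sum_add_distrib, ← Finset.mul_sum, ← Finset.mul_sum,
    ← Complex.re_sum, ← Complex.re_sum, hsum₁, hsum₂]
  gcongr
  · refine (Complex.re_le_norm _).trans ?_
    refine norm_sum_le_of_le _ fun v _ => norm_sum_le_of_le _ fun v' _ =>
      norm_sum_le_of_le _ fun u _ => norm_sum_le _ _
  · refine (Complex.re_le_norm _).trans ?_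
    exact norm_sum_le_of_le _ fun v _ => norm_sum_le _ _

lemma card_mul_card_sq_le_two_mul_norm_sq {r : ℕ} (hr : r ≠ 0) (𝒰 𝒱 : Finset ℕ)
    (hP : ∀ p ∈ 𝒰 ∪ 𝒱, p.Prime) (χ : (p : ℕ) → DirichletCharacter ℂ p)
    (hχ : ∀ p ∈ 𝒰 ∪ 𝒱, ∀ m : ℤ, ¬ ((p : ℤ) ∣ m) → χ p ((m : ZMod p) ^ r) = 1)
    {k : ℝ} (hk : k * ((𝒰.card : ℝ) + 𝒱.card) ≤
      (r : ℝ) * Real.log 2 / 4 * ((𝒰.card : ℝ) * 𝒱.card))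
    {m : ℤ} (hm : m ≠ 0) (hmk : |((m ^ r : ℤ) : ℝ)| < Real.exp k) :
    ((𝒰.card : ℝ) * 𝒱.card) ^ 2 ≤ 2 * ‖(∑ u ∈ 𝒰, χ u ((m ^ r : ℤ) : ZMod u)) *
      ∑ v ∈ 𝒱, χ v ((m ^ r : ℤ) : ZMod v)‖ ^ 2 := by
  have h𝒰 : ∀ p ∈ 𝒰, p.Prime := fun p hp => hP p (Finset.mem_union_left _ hp)
  have h𝒱 : ∀ p ∈ 𝒱, p.Prime := fun p hp => hP p (Finset.mem_union_right _ hp)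
  rw [sum_eq_card_sub_of_eq_pow 𝒰 h𝒰 χ hr (fun p hp => hχ p (Finset.mem_union_left _ hp)),
    sum_eq_card_sub_of_eq_pow 𝒱 h𝒱 χ hr (fun p hp => hχ p (Finset.mem_union_right _ hp)),
    ← Complex.ofReal_mul, Complex.norm_real, Real.norm_eq_abs, sq_abs]
  have hlog : r * Real.log |(m : ℝ)| ≤ k := by
    rw [← Real.log_pow, ← abs_pow, ← Int.cast_pow]
    have : m ^ r ≠ 0 := pow_ne_zero r hm
    exact (Real.log_le_iff_le_exp (by positivity)).2 hmk.le
  have ha := card_filter_dvd_mul_log_two_le 𝒰 h𝒰 hm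
  have hb := card_filter_dvd_mul_log_two_le 𝒱 h𝒱 hm
  set a : ℝ := ((𝒰.filter fun p : ℕ => (p : ℤ) ∣ m).card : ℝ)
  set b : ℝ := ((𝒱.filter fun p : ℕ => (p : ℤ) ∣ m).card : ℝ)
  have ha0 : 0 ≤ a := Nat.cast_nonneg _
  have hb0 : 0 ≤ b := Nat.cast_nonneg _
  set U : ℝ := (𝒰.card : ℝ)
  set V : ℝ := (𝒱.card : ℝ)
  have hU0 : 0 ≤ U := Nat.cast_nonneg _
  have hV0 : 0 ≤ V := Nat.cast_nonneg _
  have hc : 0 < r * Real.log 2 := by have := Real.log_pos one_lt_two; positivity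
  have hak : r * Real.log 2 * a ≤ k := by
    refine le_trans ?_ hlog
    calc r * Real.log 2 * a = r * (a * Real.log 2) := by ring
      _ ≤ _ := by gcongr
  have hbk : r * Real.log 2 * b ≤ k := by
    refine le_trans ?_ hlog
    calc r * Real.log 2 * b = r * (b * Real.log 2) := by ring
      _ ≤ _ := by gcongr
  have hab : a * V + b * U ≤ U * V / 4 := by
    refine le_of_mul_le_mul_left ?_ hc
    calc r * Real.log 2 * (a * V + b * U)
        = r * Real.log 2 * a * V + r * Real.log 2 * b * U := by ring
      _ ≤ k * V + k * U := by gcongr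
      _ = k * (U + V) := by ring
      _ ≤ _ := hk
      _ = _ := by ring
  have hUV : 0 ≤ U * V := mul_nonneg hU0 hV0
  have hmain : 3 / 4 * (U * V) ≤ (U - a) * (V - b) := by
    have := mul_nonneg ha0 hb0
    linarith
  have hsq := pow_le_pow_left₀ (by positivity) hmain 2
  nlinarith [sq_nonneg (U * V)]


theorem stmt4 :
    ∃ C : ℝ, ∀ (r : ℕ), 2 ≤ r →
      ∀ (𝒰 𝒱 : Finset ℕ), Disjoint 𝒰 𝒱 → 𝒰.Nonempty → 𝒱.Nonempty →
      (∀ p ∈ 𝒰 ∪ 𝒱, p.Prime ∧ p % r = 1) →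
      ∀ (χ : (p : ℕ) → DirichletCharacter ℂ p),
      (∀ p ∈ 𝒰 ∪ 𝒱, ∀ m : ℤ, ¬ ((p : ℤ) ∣ m) → χ p (((m : ZMod p)) ^ r) = 1) →
      ∀ (ω : ℤ → ℝ), (∀ n, 0 ≤ ω n) →
      (∀ n : ℤ, Real.exp ((min 𝒰.card 𝒱.card : ℕ) : ℝ) ≤ |(n : ℝ)| → ω n = 0) →
      ((𝒱.card : ℝ) ^ 3 ≤ (𝒰.card : ℝ) * (𝒱.card : ℝ)) →
      (((min 𝒰.card 𝒱.card : ℕ) : ℝ) * ((𝒰.card : ℝ) + (𝒱.card : ℝ)) ≤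
        (r : ℝ) * Real.log 2 / 4 * ((𝒰.card : ℝ) * (𝒱.card : ℝ))) →
      (∑' n : ℤ, if n ≠ 0 then ω (n ^ r) else 0) ≤
        C * (((𝒰.card : ℝ) * (𝒱.card : ℝ))⁻¹ * (∑' n : ℤ, ω n)
          + (((𝒰.card : ℝ) * (𝒱.card : ℝ)) ^ 2)⁻¹ *
              ∑ v ∈ 𝒱, ∑ v' ∈ 𝒱, ∑ u ∈ 𝒰, ∑ u' ∈ 𝒰 \ {u},
                ‖∑' n : ℤ, (ω n : ℂ) * (χ u (n : ZMod u) * χ v (n : ZMod v)) *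
                    (starRingEnd ℂ) (χ u' (n : ZMod u') * χ v' (n : ZMod v'))‖
          + (𝒰.card : ℝ) * (((𝒰.card : ℝ) * (𝒱.card : ℝ)) ^ 2)⁻¹ *
              ∑ v ∈ 𝒱, ∑ v' ∈ 𝒱 \ {v},
                ‖∑' n : ℤ, (ω n : ℂ) * χ v (n : ZMod v) *
                    (starRingEnd ℂ) (χ v' (n : ZMod v'))‖) := by
  refine ⟨12, ?_⟩
  intro r hr 𝒰 𝒱 _ hU hV hP χ hχ ω hω hsupp hV3 hbal
  have hr0 : r ≠ 0 := by omega
  have hprime : ∀ p ∈ 𝒰 ∪ 𝒱, p.Prime := fun p hp => (hP p hp).1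
  obtain ⟨N, hN⟩ := exists_nat_ge (Real.exp ((min 𝒰.card 𝒱.card : ℕ) : ℝ))
  set F : Finset ℤ := Finset.Icc (-(N : ℤ)) N with hF
  have hout : ∀ n ∉ F, ω n = 0 := fun n hn => hsupp n <| hN.trans <| by
    have : (N : ℤ) ≤ |n| := by
      by_contra! h
      exact hn (Finset.mem_Icc.2 (abs_le.1 h.le))
    exact_mod_cast this
  have hsupp' : ∀ n : ℤ, Real.exp (𝒱.card : ℝ) ≤ |(n : ℝ)| → ω n = 0 := fun n hn =>
    hsupp n ((Real.exp_le_exp.2 (by exact_mod_cast min_le_right _ _)).trans hn)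
  have hlarge := sum_weight_mul_norm_sq_le 𝒰 𝒱 (fun p hp => hprime p (Finset.mem_union_left _ hp))
    (fun p hp => hprime p (Finset.mem_union_right _ hp)) χ ω hω hsupp' hV3 F
  have htot : ∑' n : ℤ, ω n = ∑ n ∈ F, ω n := tsum_eq_sum hout
  have h₁ : ∀ u v u' v' : ℕ, ∑' n : ℤ, (ω n : ℂ) * (χ u (n : ZMod u) * χ v (n : ZMod v)) *
        (starRingEnd ℂ) (χ u' (n : ZMod u') * χ v' (n : ZMod v')) =
      ∑ n ∈ F, (ω n : ℂ) * (χ u (n : ZMod u) * χ v (n : ZMod v)) *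
        (starRingEnd ℂ) (χ u' (n : ZMod u') * χ v' (n : ZMod v')) := fun u v u' v' =>
    tsum_eq_sum fun n hn => by rw [hout n hn, Complex.ofReal_zero, zero_mul, zero_mul]
  have h₂ : ∀ v v' : ℕ, ∑' n : ℤ, (ω n : ℂ) * χ v (n : ZMod v) *
        (starRingEnd ℂ) (χ v' (n : ZMod v')) =
      ∑ n ∈ F, (ω n : ℂ) * χ v (n : ZMod v) * (starRingEnd ℂ) (χ v' (n : ZMod v')) :=
    fun v v' => tsum_eq_sum fun n hn => by rw [hout n hn, Complex.ofReal_zero, zero_mul, zero_mul]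
  simp only [h₁, h₂, htot]
  set M : Finset ℤ := F.filter fun m => m ≠ 0 ∧ m ^ r ∈ F with hM
  have hpow : ∑' n : ℤ, (if n ≠ 0 then ω (n ^ r) else 0) = ∑ m ∈ M, ω (m ^ r) := by
    rw [tsum_eq_sum (s := M)]
    · exact Finset.sum_congr rfl fun m hm => if_pos (Finset.mem_filter.1 hm).2.1
    · intro m hm
      split_ifs with hm0
      · refine hout _ fun hmF => hm (Finset.mem_filter.2 ⟨?_, hm0, hmF⟩)
        refine Finset.mem_Icc.2 (abs_le.1 (le_trans ?_ (abs_le.2 (Finset.mem_Icc.1 hmF))))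
        rw [abs_pow]
        exact le_self_pow₀ (Int.one_le_abs hm0) hr0
      · rfl
  rw [hpow]
  set G : ℤ → ℝ := fun n =>
    ω n * ‖(∑ u ∈ 𝒰, χ u (n : ZMod u)) * ∑ v ∈ 𝒱, χ v (n : ZMod v)‖ ^ 2 with hG
  set A : ℝ := (𝒰.card : ℝ) * 𝒱.card with hA
  have hA0 : 0 < A := mul_pos (by exact_mod_cast hU.card_pos) (by exact_mod_cast hV.card_pos)
  have hlow : ∀ m ∈ M, A ^ 2 * ω (m ^ r) ≤ 2 * G (m ^ r) := fun m hm => by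
    by_cases h : Real.exp ((min 𝒰.card 𝒱.card : ℕ) : ℝ) ≤ |((m ^ r : ℤ) : ℝ)|
    · simp [hG, hsupp _ h]
    · have := card_mul_card_sq_le_two_mul_norm_sq hr0 𝒰 𝒱 hprime χ hχ hbal
        (Finset.mem_filter.1 hm).2.1 (not_le.1 h)
      calc A ^ 2 * ω (m ^ r) ≤ _ := mul_le_mul_of_nonneg_right this (hω _)
        _ = 2 * G (m ^ r) := by simp only [hG]; ring
  have hfold := sum_comp_pow_le_two_mul_sum hr0 M F (fun m hm => (Finset.mem_filter.1 hm).2.2)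
    G fun n => mul_nonneg (hω n) (sq_nonneg _)
  have hmoment : A ^ 2 * ∑ m ∈ M, ω (m ^ r) ≤ 4 * ∑ n ∈ F, G n := by
    rw [Finset.mul_sum]
    refine (Finset.sum_le_sum hlow).trans ?_
    rw [← Finset.mul_sum]
    linarith
  refine le_of_mul_le_mul_left ?_ (pow_pos hA0 2)
  refine hmoment.trans ((mul_le_mul_of_nonneg_left hlarge (by norm_num)).trans ?_)
  set X := ∑ v ∈ 𝒱, ∑ v' ∈ 𝒱, ∑ u ∈ 𝒰, ∑ u' ∈ 𝒰 \ {u},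
    ‖∑ n ∈ F, (ω n : ℂ) * (χ u (n : ZMod u) * χ v (n : ZMod v)) *
      (starRingEnd ℂ) (χ u' (n : ZMod u') * χ v' (n : ZMod v'))‖ with hX
  set Y := ∑ v ∈ 𝒱, ∑ v' ∈ 𝒱 \ {v},
    ‖∑ n ∈ F, (ω n : ℂ) * χ v (n : ZMod v) * (starRingEnd ℂ) (χ v' (n : ZMod v'))‖ with hY
  have hX0 : 0 ≤ X := Finset.sum_nonneg fun _ _ => Finset.sum_nonneg fun _ _ =>
    Finset.sum_nonneg fun _ _ => Finset.sum_nonneg fun _ _ => norm_nonneg _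
  have hY0 : 0 ≤ 𝒰.card * Y := mul_nonneg (Nat.cast_nonneg _) <|
    Finset.sum_nonneg fun _ _ => Finset.sum_nonneg fun _ _ => norm_nonneg _
  have hexp : A ^ 2 * (12 * (A⁻¹ * ∑ n ∈ F, ω n + (A ^ 2)⁻¹ * X + 𝒰.card * (A ^ 2)⁻¹ * Y)) =
      12 * (A * ∑ n ∈ F, ω n + X + 𝒰.card * Y) := by
    field_simp
  rw [hexp]
  linarith
end

section
/- Let p be a prime, n ≥ 1 and d ≥ 2 integers, and let F ∈ 𝔽_p[x₁,…,xₙ] be a nonsingular form of degree d. Let H be a positive integer and let s be an integer with 0 ≤ s ≤ n. Then there is a constant C depending only on n and d such that the number of nonzero integer vectors h ∈ [−H,H]ⁿ ∩ ℤⁿ for which the singular locus of the affine variety { x : (h mod p)·∇F(x) = 0 } has dimension equal to s is at most C·( H^{n−s} + H^{n}·p^{−s} ). -/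
open MvPolynomial

section AffineSpan

variable {K Q : Type*} [Field K] [CommRing Q] [Algebra K Q] {n : ℕ}

/-- The span of `1` and the entries of a finite family; its `m`-th power consists of the values
at the family of the polynomials of degree at most `m`. -/
def spanWithOne (K : Type*) {Q : Type*} [Field K] [CommRing Q] [Algebra K Q] {n : ℕ}
    (y : Fin n → Q) : Submodule K Q :=
  Submodule.span K (insert 1 (Set.range y))

theorem one_le_spanWithOne (y : Fin n → Q) : (1 : Submodule K Q) ≤ spanWithOne K y := by
  rw [Submodule.one_le]
  exact Submodule.subset_span (Set.mem_insert _ _)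

theorem apply_mem_spanWithOne (y : Fin n → Q) (i : Fin n) : y i ∈ spanWithOne K y :=
  Submodule.subset_span (Set.mem_insert_of_mem _ (Set.mem_range_self i))

theorem spanWithOne_pow_le_span (y : Fin n → Q) (m : ℕ) :
    spanWithOne K y ^ m ≤ Submodule.span K
      (Set.range fun α : Fin n → Fin (m + 1) ↦ ∏ i, y i ^ (α i : ℕ)) := by
  induction m with
  | zero =>
    rw [pow_zero, Submodule.one_le]
    exact Submodule.subset_span ⟨0, by simp⟩
  | succ m ih =>
    rw [pow_succ]
    refine (mul_le_mul_left ih _).trans ?_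
    rw [spanWithOne, Submodule.span_mul_span, Submodule.span_le]
    rintro _ ⟨_, ⟨α, rfl⟩, z, hz, rfl⟩
    rcases hz with rfl | ⟨j, rfl⟩
    · exact Submodule.subset_span ⟨fun i ↦ (α i).castSucc, by simp⟩
    · refine Submodule.subset_span ⟨fun i ↦ if i = j then (α i).succ else (α i).castSucc, ?_⟩
      have h (i : Fin n) : y i ^ (((if i = j then (α i).succ else (α i).castSucc) :
          Fin (m + 1 + 1)) : ℕ) = y i ^ (α i : ℕ) * if i = j then y i else 1 := by
        split_ifs <;> simp [pow_succ]
      simp only [h, Finset.prod_mul_distrib]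
      simp

theorem finite_spanWithOne_pow (y : Fin n → Q) (m : ℕ) :
    Module.Finite K (spanWithOne K y ^ m : Submodule K Q) := by
  have : Module.Finite K (Submodule.span K
      (Set.range fun α : Fin n → Fin (m + 1) ↦ ∏ i, y i ^ (α i : ℕ))) :=
    FiniteDimensional.span_of_finite K (Set.finite_range _)
  exact Submodule.finiteDimensional_of_le (spanWithOne_pow_le_span y m)

theorem finrank_spanWithOne_pow_le (y : Fin n → Q) (m : ℕ) :
    Module.finrank K (spanWithOne K y ^ m : Submodule K Q) ≤ (m + 1) ^ n := by
  have : Module.Finite K (Submodule.span K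
      (Set.range fun α : Fin n → Fin (m + 1) ↦ ∏ i, y i ^ (α i : ℕ))) :=
    FiniteDimensional.span_of_finite K (Set.finite_range _)
  refine (Submodule.finrank_mono (spanWithOne_pow_le_span y m)).trans ?_
  exact (finrank_range_le_card _).trans (by simp)

theorem prod_pow_mem_pow {ι : Type*} {U : Submodule K Q} {y : ι → Q} {e : ℕ}
    (hy : ∀ i, y i ∈ U ^ e) (α : ι → ℕ) (t : Finset ι) :
    ∏ i ∈ t, y i ^ α i ∈ U ^ (e * ∑ i ∈ t, α i) := by
  classical
  induction t using Finset.induction_on with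
  | empty => simp [Submodule.one_le.mp le_rfl]
  | insert a t ha ih =>
    rw [Finset.prod_insert ha, Finset.sum_insert ha, mul_add, pow_add, pow_mul]
    exact Submodule.mul_mem_mul (Submodule.pow_mem_pow _ (hy a) _) ih

theorem pow_le_pow_of_one_le {U : Submodule K Q} (hU : 1 ≤ U) {a b : ℕ} (h : a ≤ b) :
    U ^ a ≤ U ^ b := by
  obtain ⟨c, rfl⟩ := Nat.exists_eq_add_of_le h
  rw [pow_add]
  calc U ^ a = U ^ a * 1 := (mul_one _).symm
    _ ≤ U ^ a * U ^ c := mul_le_mul_right (one_le_pow_of_one_le' hU c) _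

theorem aeval_mem_spanWithOne_pow (y : Fin n → Q) {f : MvPolynomial (Fin n) K} {m : ℕ}
    (hf : f.IsHomogeneous m) : aeval y f ∈ spanWithOne K y ^ m := by
  rw [f.as_sum, map_sum]
  refine Submodule.sum_mem _ fun α hα ↦ ?_
  rw [aeval_monomial, ← Algebra.smul_def]
  refine Submodule.smul_mem _ _ ?_
  have h := hf (mem_support_iff.mp hα)
  rw [Finsupp.weight_apply] at h
  rw [Finsupp.prod_fintype _ _ (by simp)]
  have := prod_pow_mem_pow (U := spanWithOne K y) (e := 1) (y := y)
    (fun i ↦ by simpa using apply_mem_spanWithOne y i) α Finset.univ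
  rw [Finsupp.sum_fintype _ _ (by simp)] at h
  simpa [← h] using this

end AffineSpan

section HomogeneousSystem

variable {K : Type*} [Field K] {n e : ℕ} {G : Fin n → MvPolynomial (Fin n) K}

theorem exists_homogeneous_coeffs (hG : ∀ j, (G j).IsHomogeneous e)
    {f : MvPolynomial (Fin n) K} {m : ℕ} (hf : f.IsHomogeneous m) (hem : e ≤ m)
    (hmem : f ∈ Ideal.span (Set.range G)) :
    ∃ a : Fin n → MvPolynomial (Fin n) K,
      (∀ j, (a j).IsHomogeneous (m - e)) ∧ f = ∑ j, a j * G j := by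
  obtain ⟨c, hc⟩ := Ideal.mem_span_range_iff_exists_fun.mp hmem
  refine ⟨fun j ↦ homogeneousComponent (m - e) (c j),
    fun j ↦ homogeneousComponent_isHomogeneous _ _, ?_⟩
  have h (j : Fin n) : homogeneousComponent m (c j * G j) =
      homogeneousComponent (m - e) (c j) * G j := by
    let := gradedAlgebra (σ := Fin n) (R := K)
    have := DirectSum.coe_decompose_mul_of_right_mem_of_le (homogeneousSubmodule (Fin n) K)
      (a := c j) (b := G j) ((mem_homogeneousSubmodule _ _).mpr (hG j)) hem
    simp only [← decomposition.decompose'_apply]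
    exact this
  simp_rw [← h, ← map_sum, hc]
  exact (homogeneousComponent_of_mem hf).symm ▸ (by simp)

theorem mem_ideal_of_pow_mem {I : Ideal (MvPolynomial (Fin n) K)} {N : ℕ} (hn : 1 ≤ n)
    (hI : ∀ i, (X i : MvPolynomial (Fin n) K) ^ N ∈ I)
    {f : MvPolynomial (Fin n) K} {m : ℕ} (hf : f.IsHomogeneous m) (hm : n * N ≤ m) : f ∈ I := by
  rw [f.as_sum]
  refine Ideal.sum_mem _ fun α hα ↦ ?_
  have h := hf (mem_support_iff.mp hα)
  rw [Finsupp.weight_apply, Finsupp.sum_fintype _ _ (by simp)] at h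
  obtain ⟨i, hi⟩ : ∃ i, N ≤ α i := by
    by_contra! hlt
    have : ∑ i, α i < ∑ _i : Fin n, N :=
      Finset.sum_lt_sum_of_nonempty ⟨⟨0, hn⟩, Finset.mem_univ _⟩ fun i _ ↦ hlt i
    simp at this h
    omega
  rw [monomial_eq, Finsupp.prod_fintype _ _ (by simp)]
  refine Ideal.mul_mem_left _ _ ?_
  rw [← Finset.mul_prod_erase _ _ (Finset.mem_univ i), ← Nat.sub_add_cancel hi, pow_add]
  exact Ideal.mul_mem_right _ _ (Ideal.mul_mem_left _ _ (hI i))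

theorem exists_X_pow_mem_span [IsAlgClosed K]
    (hzero : ∀ x : Fin n → K, (∀ j, aeval x (G j) = 0) → x = 0) :
    ∃ M, ∀ i, (X i : MvPolynomial (Fin n) K) ^ M ∈ Ideal.span (Set.range G) := by
  have h (i : Fin n) : (X i : MvPolynomial (Fin n) K) ∈ (Ideal.span (Set.range G)).radical := by
    rw [← vanishingIdeal_zeroLocus_eq_radical (K := K), mem_vanishingIdeal_iff]
    intro x hx
    have : x = 0 := hzero x fun j ↦ hx _ (Ideal.subset_span (Set.mem_range_self j))
    simp [this]
  choose M hM using h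
  exact ⟨∑ i, M i, fun i ↦ Ideal.pow_mem_of_pow_mem _ (hM i)
    (Finset.single_le_sum (fun _ _ ↦ Nat.zero_le _) (Finset.mem_univ i))⟩

theorem finite_over_adjoin (hn : 1 ≤ n) (he : 1 ≤ e) (hG : ∀ j, (G j).IsHomogeneous e) {M : ℕ}
    (hM : ∀ i, (X i : MvPolynomial (Fin n) K) ^ M ∈ Ideal.span (Set.range G)) :
    Module.Finite (Algebra.adjoin K (Set.range G)) (MvPolynomial (Fin n) K) := by
  set S := Algebra.adjoin K (Set.range G)
  set D := n * M + e
  set V : Submodule S (MvPolynomial (Fin n) K) := Submodule.span S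
    (Set.range fun α : Fin n → Fin (D + 1) ↦ ∏ i, (X i : MvPolynomial (Fin n) K) ^ (α i : ℕ))
  have key (m : ℕ) (f : MvPolynomial (Fin n) K) (hf : f.IsHomogeneous m) : f ∈ V := by
    induction m using Nat.strong_induction_on generalizing f with
    | _ m ih =>
    by_cases hm : D ≤ m
    · obtain ⟨a, ha, rfl⟩ := exists_homogeneous_coeffs hG hf (by omega)
        (mem_ideal_of_pow_mem hn hM hf (by omega))
      refine Submodule.sum_mem _ fun j _ ↦ ?_
      have := V.smul_mem (⟨G j, Algebra.subset_adjoin (Set.mem_range_self j)⟩ : S)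
        (ih (m - e) (by omega) (a j) (ha j))
      rwa [Algebra.smul_def, mul_comm] at this
    · rw [f.as_sum]
      refine Submodule.sum_mem _ fun α hα ↦ ?_
      have h := hf (mem_support_iff.mp hα)
      rw [Finsupp.weight_apply, Finsupp.sum_fintype _ _ (by simp)] at h
      have hle (i : Fin n) : α i < D + 1 := by
        have := Finset.single_le_sum (f := fun i ↦ α i • (1 : Fin n → ℕ) i)
          (fun _ _ ↦ Nat.zero_le _) (Finset.mem_univ i)
        simp at this h
        omega
      rw [monomial_eq, Finsupp.prod_fintype _ _ (by simp)]
      have := V.smul_mem (algebraMap K S (coeff α f)) (Submodule.subset_span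
        ⟨fun i ↦ ⟨α i, hle i⟩, rfl⟩)
      rwa [Algebra.smul_def] at this
  refine Module.Finite.of_fg_top ?_
  rw [Submodule.fg_def]
  refine ⟨_, Set.finite_range _, show V = ⊤ from ?_⟩
  rw [eq_top_iff]
  intro f _
  rw [← sum_homogeneousComponent f]
  exact Submodule.sum_mem _ fun m _ ↦ key m _ (homogeneousComponent_isHomogeneous _ _)

theorem algebraicIndependent_of_X_pow_mem (hn : 1 ≤ n) (he : 1 ≤ e)
    (hG : ∀ j, (G j).IsHomogeneous e) {M : ℕ}
    (hM : ∀ i, (X i : MvPolynomial (Fin n) K) ^ M ∈ Ideal.span (Set.range G)) :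
    AlgebraicIndependent K G := by
  have := finite_over_adjoin hn he hG hM
  refine (Algebra.IsAlgebraic.isTranscendenceBasis_of_lift_le_trdeg_of_finite K G ?_).1
  simp [MvPolynomial.trdeg_of_isDomain]

/-- By counting monomials, each variable satisfies an algebraic relation over `K[G]` whose degree
is bounded in terms of the number of variables and the degree of the forms only. -/
theorem exists_ne_zero_aeval_X_eq_zero (hG : ∀ j, (G j).IsHomogeneous e)
    (hind : AlgebraicIndependent K G) (i : Fin n) :
    ∃ P : Polynomial (Algebra.adjoin K (Set.range G)), P ≠ 0 ∧
      P.natDegree ≤ (n * e + 1) ^ n ∧ Polynomial.aeval (X i : MvPolynomial (Fin n) K) P = 0 := by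
  set N := (n * e + 1) ^ n
  set U := spanWithOne K (X : Fin n → MvPolynomial (Fin n) K)
  set D := N + e * (n * (N + 1))
  let v : Fin (N + 1) × (Fin n → Fin (N + 1)) → MvPolynomial (Fin n) K :=
    fun q ↦ X i ^ (q.1 : ℕ) * ∏ j, G j ^ (q.2 j : ℕ)
  have hU : 1 ≤ U := one_le_spanWithOne _
  have hGU (j : Fin n) : G j ∈ U ^ e := by
    simpa using aeval_mem_spanWithOne_pow (X : Fin n → MvPolynomial (Fin n) K) (hG j)
  have hv (q) : v q ∈ U ^ D := by
    refine (pow_add U N _).ge (Submodule.mul_mem_mul ?_ ?_)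
    · exact pow_le_pow_of_one_le hU (Nat.lt_succ_iff.mp q.1.2)
        (Submodule.pow_mem_pow _ (apply_mem_spanWithOne _ i) _)
    · refine pow_le_pow_of_one_le hU ?_ (prod_pow_mem_pow hGU (fun j ↦ (q.2 j : ℕ)) Finset.univ)
      refine Nat.mul_le_mul_left _ ?_
      calc ∑ j, (q.2 j : ℕ) ≤ ∑ _j : Fin n, (N + 1) :=
            Finset.sum_le_sum fun j _ ↦ (q.2 j).2.le
        _ = n * (N + 1) := by simp
  have hdep : ¬ LinearIndependent K v := by
    intro hli
    have := finite_spanWithOne_pow (K := K) (X : Fin n → MvPolynomial (Fin n) K) D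
    have : Module.Finite K (Submodule.span K (Set.range v)) :=
      FiniteDimensional.span_of_finite K (Set.finite_range v)
    have h1 := (linearIndependent_span hli).fintype_card_le_finrank
    have h2 : Module.finrank K (Submodule.span K (Set.range v)) ≤ (D + 1) ^ n :=
      (Submodule.finrank_mono (Submodule.span_le.mpr (Set.range_subset_iff.mpr hv))).trans
        (finrank_spanWithOne_pow_le _ D)
    have h3 : D + 1 = (n * e + 1) * (N + 1) := by simp only [D]; ring
    rw [h3, mul_pow] at h2
    have h4 := h1.trans h2
    simp only [Fintype.card_prod, Fintype.card_fin, Fintype.card_pi, Finset.prod_const,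
      Finset.card_univ] at h4
    have h5 := Nat.le_of_mul_le_mul_right h4 (by positivity)
    omega
  rw [Fintype.not_linearIndependent_iff] at hdep
  obtain ⟨g, hg, q₀, hq₀⟩ := hdep
  let A : Fin (N + 1) × (Fin n → Fin (N + 1)) → MvPolynomial (Fin n) K :=
    fun q ↦ monomial (Finsupp.equivFunOnFinite.symm fun j ↦ (q.2 j : ℕ)) (g q)
  let P : Polynomial (MvPolynomial (Fin n) K) := ∑ q, Polynomial.monomial (q.1 : ℕ) (A q)
  have hP : P ≠ 0 := by
    intro h0
    have := congrArg (fun P : Polynomial (MvPolynomial (Fin n) K) ↦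
      coeff (Finsupp.equivFunOnFinite.symm fun j ↦ (q₀.2 j : ℕ)) (P.coeff q₀.1)) h0
    simp only [P, A, Polynomial.finsetSum_coeff, Polynomial.coeff_monomial, coeff_sum,
      Polynomial.coeff_zero, coeff_zero] at this
    rw [Finset.sum_eq_single q₀] at this
    · simp at this
      exact hq₀ this
    · intro q _ hq
      split_ifs with h1
      · rw [coeff_monomial, if_neg]
        intro h2
        refine hq (Prod.ext (Fin.ext h1) (funext fun j ↦ Fin.ext ?_))
        simpa using DFunLike.congr_fun h2 j
      · simp
    · simp
  refine ⟨P.map (hind.aevalEquiv : MvPolynomial (Fin n) K →+* _), ?_, ?_, ?_⟩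
  · rwa [Ne, Polynomial.map_eq_zero_iff hind.aevalEquiv.injective]
  · refine Polynomial.natDegree_map_le.trans ?_
    refine Polynomial.natDegree_sum_le_of_forall_le _ _ fun q _ ↦ ?_
    exact (Polynomial.natDegree_monomial_le _).trans (Nat.lt_succ_iff.mp q.1.2)
  · rw [← hg]
    simp only [P, A, Polynomial.map_sum, Polynomial.map_monomial, map_sum,
      Polynomial.aeval_monomial]
    refine Finset.sum_congr rfl fun q _ ↦ ?_
    have : algebraMap (Algebra.adjoin K (Set.range G)) (MvPolynomial (Fin n) K)
        (hind.aevalEquiv (A q)) = g q • ∏ j, G j ^ (q.2 j : ℕ) := by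
      rw [hind.algebraMap_aevalEquiv, aeval_monomial, Finsupp.prod_fintype _ _ (by simp),
        Algebra.smul_def]
      simp
    simp only [v]
    erw [this]
    rw [smul_mul_assoc, mul_comm]

/-- An effective Nullstellensatz for `n` forms of degree `e` in `n` variables. -/
theorem X_pow_mem_span [IsAlgClosed K] (hn : 1 ≤ n) (he : 1 ≤ e)
    (hG : ∀ j, (G j).IsHomogeneous e)
    (hzero : ∀ x : Fin n → K, (∀ j, aeval x (G j) = 0) → x = 0) (i : Fin n) :
    (X i : MvPolynomial (Fin n) K) ^ ((n * e + 1) ^ n) ∈ Ideal.span (Set.range G) := by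
  obtain ⟨M, hM⟩ := exists_X_pow_mem_span hzero
  have hfin := finite_over_adjoin hn he hG hM
  have hind := algebraicIndependent_of_X_pow_mem hn he hG hM
  obtain ⟨P, hP0, hPdeg, hP⟩ := exists_ne_zero_aeval_X_eq_zero hG hind i
  set S := Algebra.adjoin K (Set.range G)
  have : IsIntegrallyClosed S := IsIntegrallyClosed.of_equiv hind.aevalEquiv.toRingEquiv
  have hint : IsIntegral S (X i : MvPolynomial (Fin n) K) := Algebra.IsIntegral.isIntegral _
  set μ := minpoly S (X i : MvPolynomial (Fin n) K)
  have hμdeg : μ.natDegree ≤ (n * e + 1) ^ n :=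
    (Polynomial.natDegree_le_of_dvd (minpoly.isIntegrallyClosed_dvd hint hP) hP0).trans hPdeg
  set I := Ideal.span (Set.range G)
  let ψ : S →ₐ[K] MvPolynomial (Fin n) K ⧸ I := (Ideal.Quotient.mkₐ K I).comp S.val
  have hψ (a : S) : ∃ c : K, algebraMap K (MvPolynomial (Fin n) K ⧸ I) c = ψ a := by
    have hle : S ≤ (⊥ : Subalgebra K (MvPolynomial (Fin n) K ⧸ I)).comap
        (Ideal.Quotient.mkₐ K I) := by
      refine Algebra.adjoin_le ?_
      rintro _ ⟨j, rfl⟩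
      have : Ideal.Quotient.mkₐ K I (G j) = 0 :=
        Ideal.Quotient.eq_zero_iff_mem.mpr (Ideal.subset_span (Set.mem_range_self j))
      simp only [SetLike.mem_coe, Subalgebra.mem_comap, this]
      exact zero_mem _
    exact Algebra.mem_bot.mp (hle a.2)
  obtain ⟨q, hqmap, hqdeg, hqmonic⟩ : ∃ q : Polynomial K,
      q.map (algebraMap K (MvPolynomial (Fin n) K ⧸ I)) = μ.map (ψ : S →+* _) ∧
      q.natDegree ≤ μ.natDegree ∧ q ≠ 0 := by
    obtain ⟨q, h1, h2, h3⟩ := Polynomial.lifts_and_natDegree_eq_and_monic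
      (f := algebraMap K (MvPolynomial (Fin n) K ⧸ I)) (p := μ.map (ψ : S →+* _))
      ((Polynomial.lifts_iff_coeff_lifts _).mpr fun m ↦ by
        rw [Polynomial.coeff_map]
        exact hψ _) ((minpoly.monic hint).map _)
    exact ⟨q, h1, h2.le.trans Polynomial.natDegree_map_le, h3.ne_zero⟩
  have hroot : Polynomial.aeval (Ideal.Quotient.mkₐ K I (X i)) q = 0 := by
    rw [Polynomial.aeval_def, ← Polynomial.eval_map, hqmap, Polynomial.eval_map]
    have h1 : Polynomial.eval₂ (algebraMap S (MvPolynomial (Fin n) K)) (X i) μ = 0 :=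
      minpoly.aeval S _
    have h2 := congrArg (Ideal.Quotient.mkₐ K I) h1
    rw [map_zero] at h2
    rw [← h2]
    exact (Polynomial.hom_eval₂ μ _ (Ideal.Quotient.mk I) (X i)).symm
  have hnil : Polynomial.aeval (Ideal.Quotient.mkₐ K I (X i)) (Polynomial.X ^ M : Polynomial K)
      = 0 := by
    simpa using Ideal.Quotient.eq_zero_iff_mem.mpr (hM i)
  obtain ⟨k, -, hk⟩ := (dvd_prime_pow Polynomial.prime_X M).mp (minpoly.dvd K _ hnil)
  have hkdeg : k ≤ (n * e + 1) ^ n := by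
    have h1 := Polynomial.natDegree_eq_of_degree_eq (Polynomial.degree_eq_degree_of_associated hk)
    rw [Polynomial.natDegree_X_pow] at h1
    have := Polynomial.natDegree_le_of_dvd (minpoly.dvd K _ hroot) hqmonic
    omega
  have hkmem : (X i : MvPolynomial (Fin n) K) ^ k ∈ I := by
    obtain ⟨r, hr⟩ := hk.dvd
    have := congrArg (Polynomial.aeval (Ideal.Quotient.mkₐ K I (X i))) hr
    rw [map_mul, minpoly.aeval, zero_mul] at this
    exact Ideal.Quotient.eq_zero_iff_mem.mp (by simpa using this)
  exact Ideal.pow_mem_of_pow_mem _ hkmem hkdeg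

end HomogeneousSystem

section KrullDimension

theorem ringKrullDim_le_of_isIntegral {R A : Type*} [CommRing R] [CommRing A] (f : R →+* A)
    (hf : f.IsIntegral) : ringKrullDim A ≤ ringKrullDim R := by
  algebraize [f]
  exact Order.krullDim_le_of_strictMono (PrimeSpectrum.comap f) fun I J hIJ ↦
    Ideal.IsIntegral.comap_lt_comap (I := I.asIdeal) (J := J.asIdeal) hIJ

variable {K : Type*} [Field K] {n : ℕ}

theorem exists_algebraicIndependent_of_isDomain {D : Type*} [CommRing D] [IsDomain D]
    [Algebra K D] {x : Fin n → D} (hx : Algebra.adjoin K (Set.range x) = ⊤) {s : ℕ}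
    (hs : (s : WithBot ℕ∞) ≤ ringKrullDim D) :
    ∃ σ : Fin s → Fin n, AlgebraicIndependent K (fun k ↦ x (σ k)) := by
  have hft : Algebra.FiniteType K D :=
    ⟨hx ▸ Subalgebra.fg_def.mpr ⟨_, Set.finite_range x, rfl⟩⟩
  obtain ⟨r, g, hg, hgint⟩ := exists_integral_inj_algHom_of_fg K D
  have hsr : s ≤ r := by
    have h := hs.trans (ringKrullDim_le_of_isIntegral _ hgint)
    rw [MvPolynomial.ringKrullDim_of_isNoetherianRing, ringKrullDim_eq_zero_of_field] at h
    rw [zero_add, Nat.card_eq_fintype_card, Fintype.card_fin] at h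
    exact_mod_cast h
  have htr : (r : Cardinal) ≤ Algebra.trdeg K D := by
    simpa [MvPolynomial.trdeg_of_isDomain] using lift_trdeg_le_of_injective g hg
  have : Algebra.IsAlgebraic (Algebra.adjoin K (Set.range x)) D := by
    rw [hx]
    exact ⟨fun a ↦ isAlgebraic_algebraMap (⟨a, trivial⟩ : (⊤ : Subalgebra K D))⟩
  obtain ⟨t, htx, ht⟩ := exists_isTranscendenceBasis_subset (R := K) (Set.range x)
  have hcard : (s : Cardinal) ≤ Cardinal.mk t := by
    rw [ht.cardinalMk_eq_trdeg]
    refine le_trans ?_ htr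
    exact_mod_cast hsr
  have : Nonempty (Fin s ↪ t) := by
    rw [← Cardinal.lift_mk_le']
    simpa using hcard
  obtain ⟨ι⟩ := this
  choose σ hσ using fun k ↦ htx (ι k).2
  refine ⟨σ, ?_⟩
  simp_rw [hσ]
  exact ht.1.comp ι ι.injective

/-- If the Krull dimension of a finitely generated algebra is at least `s`, then some `s` of
the given generators are algebraically independent. -/
theorem exists_algebraicIndependent_of_le_ringKrullDim {A : Type*} [CommRing A] [Algebra K A]
    {x : Fin n → A} (hx : Algebra.adjoin K (Set.range x) = ⊤) {s : ℕ}
    (hs : (s : WithBot ℕ∞) ≤ ringKrullDim A) :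
    ∃ σ : Fin s → Fin n, AlgebraicIndependent K (fun k ↦ x (σ k)) := by
  obtain ⟨l, rfl⟩ := Order.le_krullDim_iff.mp hs
  have hdim : (l.length : WithBot ℕ∞) ≤ ringKrullDim (A ⧸ l.head.asIdeal) := by
    rw [ringKrullDim_quotient]
    refine Order.le_krullDim_iff.mpr ⟨⟨l.length, fun i ↦ ⟨l i, ?_⟩, fun i ↦ l.step i⟩, rfl⟩
    exact LTSeries.head_le l i
  let π := Ideal.Quotient.mkₐ K l.head.asIdeal
  have hgen : Algebra.adjoin K (Set.range (π ∘ x)) = ⊤ := by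
    rw [Set.range_comp, Algebra.adjoin_image, hx, Algebra.map_top, AlgHom.range_eq_top]
    exact Ideal.Quotient.mkₐ_surjective K _
  obtain ⟨σ, hσ⟩ := exists_algebraicIndependent_of_isDomain hgen hdim
  exact ⟨σ, AlgebraicIndependent.of_comp π hσ⟩

end KrullDimension

section ModuleBound

variable {K Q : Type*} [Field K] [CommRing Q] [Algebra K Q] {n : ℕ}

theorem exists_aeval_eq_of_mem_spanWithOne_pow (y : Fin n → Q) {m : ℕ} {z : Q}
    (hz : z ∈ spanWithOne K y ^ m) :
    ∃ f : MvPolynomial (Fin n) K, f.totalDegree ≤ m ∧ aeval y f = z := by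
  have h1 : spanWithOne K y ≤
      (restrictTotalDegree (Fin n) K 1).map (aeval y).toLinearMap := by
    refine Submodule.span_le.mpr (Set.insert_subset ⟨1, ?_, by simp⟩ ?_)
    · simp [mem_restrictTotalDegree]
    · rintro _ ⟨i, rfl⟩
      exact ⟨X i, by simp [mem_restrictTotalDegree], by simp⟩
  have h2 (m : ℕ) : spanWithOne K y ^ m ≤
      (restrictTotalDegree (Fin n) K m).map (aeval y).toLinearMap := by
    induction m with
    | zero =>
      rw [pow_zero, Submodule.one_le]
      exact ⟨1, by simp [mem_restrictTotalDegree], by simp⟩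
    | succ m ih =>
      rw [pow_succ, Submodule.mul_le]
      intro a ha b hb
      obtain ⟨f, hf, rfl⟩ := ih ha
      obtain ⟨g, hg, rfl⟩ := h1 hb
      simp only [SetLike.mem_coe, mem_restrictTotalDegree] at hf hg
      refine ⟨f * g, ?_, by simp⟩
      simp only [SetLike.mem_coe, mem_restrictTotalDegree]
      exact (totalDegree_mul f g).trans (add_le_add hf hg)
  obtain ⟨f, hf, rfl⟩ := h2 m hz
  exact ⟨f, by simpa [mem_restrictTotalDegree] using hf, rfl⟩

variable {e M : ℕ} {G : Fin n → MvPolynomial (Fin n) K} {ξ υ : Fin n → Q}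

theorem spanWithOne_pow_succ_le (he : 1 ≤ e) (hG : ∀ j, (G j).IsHomogeneous e) (heM : e ≤ M + 1)
    (hM : ∀ f : MvPolynomial (Fin n) K, f.IsHomogeneous (M + 1) →
      f ∈ Ideal.span (Set.range G))
    (hrel : ∀ j, ∃ H : Fin n → MvPolynomial (Fin n) K, (∀ i, (H i).IsHomogeneous (e - 1)) ∧
      aeval ξ (G j) = ∑ i, aeval ξ (H i) * υ i) :
    spanWithOne K ξ ^ (M + 1) ≤ spanWithOne K ξ ^ M * spanWithOne K υ := by
  intro z hz
  obtain ⟨f, hf, rfl⟩ := exists_aeval_eq_of_mem_spanWithOne_pow ξ hz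
  rw [← sum_homogeneousComponent f, map_sum]
  refine Submodule.sum_mem _ fun k hk ↦ ?_
  have hhom := homogeneousComponent_isHomogeneous k f
  by_cases hkM : k ≤ M
  · rw [← mul_one (aeval ξ (homogeneousComponent k f))]
    exact Submodule.mul_mem_mul (pow_le_pow_of_one_le (one_le_spanWithOne ξ) hkM
      (aeval_mem_spanWithOne_pow ξ hhom)) (Submodule.one_le.mp (one_le_spanWithOne υ))
  · obtain rfl : k = M + 1 := by
      have := Finset.mem_range.mp hk
      omega
    obtain ⟨a, ha, hfa⟩ := exists_homogeneous_coeffs hG hhom heM (hM _ hhom)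
    rw [hfa, map_sum]
    refine Submodule.sum_mem _ fun j _ ↦ ?_
    obtain ⟨H, hH, hGH⟩ := hrel j
    rw [map_mul, hGH, Finset.mul_sum]
    refine Submodule.sum_mem _ fun i _ ↦ ?_
    rw [← mul_assoc, ← map_mul]
    refine Submodule.mul_mem_mul (aeval_mem_spanWithOne_pow ξ ?_) (apply_mem_spanWithOne υ i)
    convert (ha j).mul (hH i) using 1
    omega

theorem sup_pow_le {A B : Submodule K Q} (hA : 1 ≤ A) (hB : 1 ≤ B) (h : A ^ (M + 1) ≤ A ^ M * B)
    (T : ℕ) : (A ⊔ B) ^ T ≤ A ^ M * B ^ (2 * T) := by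
  have hAB (k : ℕ) : A ^ (M + k) ≤ A ^ M * B ^ k := by
    induction k with
    | zero => simp
    | succ k ih =>
      calc A ^ (M + (k + 1)) = A ^ (M + k) * A := by rw [← add_assoc, pow_succ]
        _ ≤ A ^ M * B ^ k * A := mul_le_mul_left ih _
        _ = A ^ (M + 1) * B ^ k := by rw [pow_succ]; ring
        _ ≤ A ^ M * B * B ^ k := mul_le_mul_left h _
        _ = A ^ M * B ^ (k + 1) := by rw [pow_succ]; ring
  have hsup : A ⊔ B ≤ A * B := by
    refine sup_le ?_ ?_
    · calc A = A * 1 := (mul_one _).symm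
        _ ≤ A * B := mul_le_mul_right hB _
    · calc B = 1 * B := (one_mul _).symm
        _ ≤ A * B := mul_le_mul_left hA _
  calc (A ⊔ B) ^ T ≤ (A * B) ^ T := pow_le_pow_left' hsup T
    _ = A ^ T * B ^ T := mul_pow _ _ _
    _ ≤ A ^ (M + T) * B ^ T := mul_le_mul_left (pow_le_pow_of_one_le hA (by omega)) _
    _ ≤ A ^ M * B ^ T * B ^ T := mul_le_mul_left (hAB T) _
    _ = A ^ M * B ^ (2 * T) := by rw [mul_assoc, ← pow_add, two_mul]

theorem card_le_of_linearIndependent {ι : Type*} [Fintype ι] {w : ι → Q} {T : ℕ}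
    (hw : LinearIndependent K w)
    (h : spanWithOne K ξ ^ (M + 1) ≤ spanWithOne K ξ ^ M * spanWithOne K υ)
    (hwT : ∀ i, w i ∈ (spanWithOne K ξ ⊔ spanWithOne K υ) ^ T) :
    Fintype.card ι ≤ (M + 1) ^ n * (2 * T + 1) ^ n := by
  let v : (Fin n → Fin (M + 1)) × (Fin n → Fin (2 * T + 1)) → Q :=
    fun q ↦ (∏ i, ξ i ^ (q.1 i : ℕ)) * ∏ i, υ i ^ (q.2 i : ℕ)
  have hle : (spanWithOne K ξ ⊔ spanWithOne K υ) ^ T ≤ Submodule.span K (Set.range v) := by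
    refine (sup_pow_le (one_le_spanWithOne ξ) (one_le_spanWithOne υ) h T).trans ?_
    refine (mul_le_mul' (spanWithOne_pow_le_span ξ M) (spanWithOne_pow_le_span υ (2 * T))).trans ?_
    rw [Submodule.span_mul_span, Submodule.span_le]
    rintro _ ⟨_, ⟨α, rfl⟩, _, ⟨β, rfl⟩, rfl⟩
    exact Submodule.subset_span ⟨(α, β), rfl⟩
  have : Module.Finite K (Submodule.span K (Set.range v)) :=
    FiniteDimensional.span_of_finite K (Set.finite_range v)
  have : Module.Finite K (Submodule.span K (Set.range w)) :=
    FiniteDimensional.span_of_finite K (Set.finite_range w)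
  calc Fintype.card ι ≤ Module.finrank K (Submodule.span K (Set.range w)) :=
        (linearIndependent_span hw).fintype_card_le_finrank
    _ ≤ Module.finrank K (Submodule.span K (Set.range v)) :=
        Submodule.finrank_mono (Submodule.span_le.mpr
          (Set.range_subset_iff.mpr fun i ↦ hle (hwT i)))
    _ ≤ _ := (finrank_range_le_card _).trans (by simp)

end ModuleBound

section GridPoints

variable {K : Type*} [Field K] {n : ℕ}

theorem pderiv_pderiv_comm (i j : Fin n) (f : MvPolynomial (Fin n) K) :
    pderiv i (pderiv j f) = pderiv j (pderiv i f) := by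
  have h : ⁅pderiv (R := K) i, pderiv (R := K) j⁆ = 0 := by
    refine derivation_ext fun k ↦ ?_
    simp [Derivation.commutator_apply, pderiv_X, Pi.single_apply, apply_ite]
  rw [← sub_eq_zero, ← Derivation.commutator_apply, h, Derivation.zero_apply]

/-- A family indexed by a finite subset `S` of the grid `Bⁿ` of the products of indicator
polynomials on `S` with monomials in coordinates independent modulo the given ideals. -/
theorem exists_linearIndependent_grid {B : Finset K} {S : Finset (Fin n → K)}
    (hSB : ∀ h ∈ S, ∀ i, h i ∈ B) (J : (Fin n → K) → Ideal (MvPolynomial (Fin n) K)) {s : ℕ}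
    (hsn : s ≤ n) (hdim : ∀ h ∈ S, ∃ σ : Fin s → Fin n,
      AlgebraicIndependent K (fun k ↦ Ideal.Quotient.mkₐ K (J h) (X (σ k))))
    {U : Submodule K (∀ h : S, MvPolynomial (Fin n) K ⧸ J h)} (hU : 1 ≤ U)
    (hX : ∀ i, (fun h : S ↦ Ideal.Quotient.mkₐ K (J h) (X i)) ∈ U)
    (hC : ∀ i, (fun h : S ↦ algebraMap K (MvPolynomial (Fin n) K ⧸ J h) (h.1 i)) ∈ U) :
    ∃ w : S × (Fin s → Fin B.card) → ∀ h : S, MvPolynomial (Fin n) K ⧸ J h,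
      LinearIndependent K w ∧ ∀ q, w q ∈ U ^ (2 * n * B.card) := by
  classical
  have : Nonempty (Fin s → Fin n) := ⟨Fin.castLE hsn⟩
  choose! σ hσ using hdim
  let ξ (i : Fin n) : ∀ h : S, MvPolynomial (Fin n) K ⧸ J h :=
    fun h ↦ Ideal.Quotient.mkₐ K (J h) (X i)
  let η (i : Fin n) : ∀ h : S, MvPolynomial (Fin n) K ⧸ J h :=
    fun h ↦ algebraMap K _ (h.1 i)
  let δ (h₀ h : Fin n → K) : K := ∏ i, ∏ c ∈ B.erase (h₀ i), (h i - c)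
  have hδ {h₀ h : Fin n → K} (hh : h ∈ S) (hne : h ≠ h₀) : δ h₀ h = 0 := by
    obtain ⟨i, hi⟩ := Function.ne_iff.mp hne
    exact Finset.prod_eq_zero (Finset.mem_univ i) (Finset.prod_eq_zero
      (Finset.mem_erase.mpr ⟨hi, hSB h hh i⟩) (sub_self _))
  have hδ0 (h₀ : Fin n → K) : δ h₀ h₀ ≠ 0 :=
    Finset.prod_ne_zero_iff.mpr fun i _ ↦ Finset.prod_ne_zero_iff.mpr fun c hc ↦
      sub_ne_zero.mpr (Finset.ne_of_mem_erase hc).symm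
  let w : S × (Fin s → Fin B.card) → ∀ h : S, MvPolynomial (Fin n) K ⧸ J h :=
    fun q ↦ (∏ i, ∏ c ∈ B.erase (q.1.1 i), (η i - algebraMap K _ c)) *
      ∏ k, ξ (σ q.1.1 k) ^ (q.2 k : ℕ)
  have hw (q) (h : S) : w q h = algebraMap K _ (δ q.1.1 h.1) *
      ∏ k, Ideal.Quotient.mkₐ K (J h) (X (σ q.1.1 k)) ^ (q.2 k : ℕ) := by
    simp [w, δ, ξ, η, Finset.prod_apply]
  refine ⟨w, ?_, fun q ↦ ?_⟩
  · rw [Fintype.linearIndependent_iff]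
    intro g hg q₀
    have h1 := congrFun hg q₀.1
    let f : MvPolynomial (Fin s) K := ∑ α : Fin s → Fin B.card,
      monomial (Finsupp.equivFunOnFinite.symm fun k ↦ (α k : ℕ))
        (g (q₀.1, α) * δ q₀.1.1 q₀.1.1)
    have hf : aeval (fun k ↦ Ideal.Quotient.mkₐ K (J q₀.1) (X (σ q₀.1.1 k))) f = 0 := by
      rw [Pi.zero_apply, Finset.sum_apply, Fintype.sum_prod_type,
        Finset.sum_eq_single q₀.1] at h1
      · rw [← h1]
        simp only [f, map_sum]
        refine Finset.sum_congr rfl fun α _ ↦ ?_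
        rw [aeval_monomial, Finsupp.prod_fintype _ _ (by simp), Pi.smul_apply, hw,
          map_mul, mul_assoc]
        exact (Algebra.smul_def _ _).symm
      · intro h _ hne
        refine Finset.sum_eq_zero fun α _ ↦ ?_
        rw [Pi.smul_apply, hw, hδ q₀.1.2 fun h' ↦ hne (Subtype.ext h'.symm)]
        simp
      · simp
    have hf0 : f = 0 := (hσ q₀.1.1 q₀.1.2).eq_zero_of_aeval_eq_zero f hf
    have h2 := congrArg (coeff (Finsupp.equivFunOnFinite.symm fun k ↦ (q₀.2 k : ℕ))) hf0
    simp only [f, coeff_sum, coeff_zero] at h2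
    rw [Finset.sum_eq_single q₀.2] at h2
    · simpa [hδ0] using h2
    · intro α _ hα
      rw [coeff_monomial, if_neg]
      intro h3
      exact hα (funext fun j ↦ Fin.ext (by simpa using DFunLike.congr_fun h3 j))
    · simp
  · have h1 (i : Fin n) : ∏ c ∈ B.erase (q.1.1 i), (η i - algebraMap K _ c) ∈ U ^ B.card := by
      have := prod_pow_mem_pow (U := U) (e := 1)
        (y := fun c : K ↦ η i - algebraMap K _ c) (fun c ↦ by
          rw [pow_one]
          refine U.sub_mem (hC i) ?_
          rw [Algebra.algebraMap_eq_smul_one]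
          exact U.smul_mem _ (Submodule.one_le.mp hU)) (fun _ ↦ 1) (B.erase (q.1.1 i))
      simp only [pow_one, Finset.sum_const, smul_eq_mul, mul_one, one_mul] at this
      exact pow_le_pow_of_one_le hU (Finset.card_erase_le) this
    have h2 := prod_pow_mem_pow h1 (fun _ ↦ 1) Finset.univ
    simp only [pow_one, Finset.sum_const, smul_eq_mul, mul_one, Finset.card_univ,
      Fintype.card_fin] at h2
    have h3 := prod_pow_mem_pow (U := U) (e := 1) (y := fun k ↦ ξ (σ q.1.1 k))
      (fun k ↦ by rw [pow_one]; exact hX _) (fun k ↦ (q.2 k : ℕ)) Finset.univ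
    have h4 : 1 * ∑ k, (q.2 k : ℕ) ≤ n * B.card := by
      calc 1 * ∑ k, (q.2 k : ℕ) ≤ 1 * ∑ _k : Fin s, B.card :=
            Nat.mul_le_mul_left _ (Finset.sum_le_sum fun k _ ↦ (q.2 k).2.le)
        _ = s * B.card := by simp
        _ ≤ n * B.card := Nat.mul_le_mul_right _ hsn
    have h5 := Submodule.mul_mem_mul h2 (pow_le_pow_of_one_le hU h4 h3)
    rw [← pow_add] at h5
    convert h5 using 2
    ring

/-- The bound for points of a grid: if, for every `h` in a subset `S` of `Bⁿ`, the ideal `J h`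
contains the partial derivatives of `h·∇F` and has `s` independent coordinates modulo it,
then `S` has `O(|B|^(n-s))` elements. -/
theorem card_mul_pow_le [IsAlgClosed K] (hn : 1 ≤ n) {d : ℕ} (hd : 2 ≤ d)
    (hdK : ((d - 1 : ℕ) : K) ≠ 0) {F : MvPolynomial (Fin n) K} (hF : F.IsHomogeneous d)
    (hzero : ∀ x : Fin n → K, (∀ j, aeval x (pderiv j F) = 0) → x = 0)
    {B : Finset K} {S : Finset (Fin n → K)} (hSB : ∀ h ∈ S, ∀ i, h i ∈ B)
    (J : (Fin n → K) → Ideal (MvPolynomial (Fin n) K))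
    (hJ : ∀ h ∈ S, ∀ j, ∑ i, C (h i) * pderiv j (pderiv i F) ∈ J h) {s : ℕ} (hsn : s ≤ n)
    (hdim : ∀ h ∈ S, ∃ σ : Fin s → Fin n,
      AlgebraicIndependent K (fun k ↦ Ideal.Quotient.mkₐ K (J h) (X (σ k)))) :
    S.card * B.card ^ s ≤
      (n * (n * (d - 1) + 1) ^ n) ^ n * (2 * (2 * n * B.card) + 1) ^ n := by
  set N := (n * (d - 1) + 1) ^ n
  have hG (j : Fin n) : (pderiv j F).IsHomogeneous (d - 1) := hF.pderiv
  have hN : n * (d - 1) + 1 ≤ N := Nat.le_self_pow (by omega) _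
  have hdN : d - 1 ≤ n * N := by nlinarith
  have hnN : n * N - 1 + 1 = n * N := by
    have : 1 ≤ n * N := by nlinarith
    omega
  let ξ (i : Fin n) : ∀ h : S, MvPolynomial (Fin n) K ⧸ J h :=
    fun h ↦ Ideal.Quotient.mkₐ K (J h) (X i)
  let υ (i : Fin n) : ∀ h : S, MvPolynomial (Fin n) K ⧸ J h :=
    fun h ↦ algebraMap K _ (h.1 i) - ξ i h
  have hξ (f : MvPolynomial (Fin n) K) (h : S) :
      aeval ξ f h = Ideal.Quotient.mkₐ K (J h) f := by
    have : (Pi.evalAlgHom K (fun h : S ↦ MvPolynomial (Fin n) K ⧸ J h) h).comp (aeval ξ) =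
        Ideal.Quotient.mkₐ K (J h) := by
      refine algHom_ext fun i ↦ ?_
      simp [ξ]
    exact DFunLike.congr_fun this f
  have hrel (j : Fin n) : ∃ H : Fin n → MvPolynomial (Fin n) K,
      (∀ i, (H i).IsHomogeneous (d - 1 - 1)) ∧
      aeval ξ (pderiv j F) = ∑ i, aeval ξ (H i) * υ i := by
    refine ⟨fun i ↦ C (-((d - 1 : ℕ) : K)⁻¹) * pderiv i (pderiv j F),
      fun i ↦ (hG j).pderiv.C_mul _, ?_⟩
    funext h
    have heuler := (hG j).sum_X_mul_pderiv
    rw [Finset.sum_apply]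
    simp only [Pi.mul_apply, hξ, υ, ξ]
    have hpoly : pderiv j F = ∑ i, C (-((d - 1 : ℕ) : K)⁻¹) * pderiv i (pderiv j F) *
        (C (h.1 i) - X i) +
        C (((d - 1 : ℕ) : K)⁻¹) * ∑ i, C (h.1 i) * pderiv j (pderiv i F) := by
      have h1 : ∑ i, C (-((d - 1 : ℕ) : K)⁻¹) * pderiv i (pderiv j F) * (C (h.1 i) - X i) =
          C (((d - 1 : ℕ) : K)⁻¹) * ((∑ i, X i * pderiv i (pderiv j F)) -
            ∑ i, C (h.1 i) * pderiv j (pderiv i F)) := by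
        rw [← Finset.sum_sub_distrib, Finset.mul_sum]
        refine Finset.sum_congr rfl fun i _ ↦ ?_
        rw [pderiv_pderiv_comm j i, C_neg]
        ring
      rw [h1, heuler, ← mul_add, sub_add_cancel, nsmul_eq_mul, ← mul_assoc, ← C_eq_coe_nat,
        ← C_mul, inv_mul_cancel₀ hdK, C_1, one_mul]
    conv_lhs => rw [hpoly]
    have hmem : Ideal.Quotient.mkₐ K (J h)
        (C (((d - 1 : ℕ) : K)⁻¹) * ∑ i, C (h.1 i) * pderiv j (pderiv i F)) = 0 :=
      Ideal.Quotient.eq_zero_iff_mem.mpr (Ideal.mul_mem_left _ _ (hJ h.1 h.2 j))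
    rw [map_add, hmem, add_zero, map_sum]
    refine Finset.sum_congr rfl fun i _ ↦ ?_
    rw [map_mul, map_sub]
    rfl
  have hstep := spanWithOne_pow_succ_le (M := n * N - 1) (ξ := ξ) (υ := υ) (by omega) hG
    (by omega) (fun f hf ↦ mem_ideal_of_pow_mem hn
      (X_pow_mem_span hn (by omega) hG hzero) hf hnN.ge) hrel
  obtain ⟨w, hw, hwU⟩ := exists_linearIndependent_grid hSB J hsn hdim
    (U := spanWithOne K ξ ⊔ spanWithOne K υ)
    ((one_le_spanWithOne ξ).trans le_sup_left)
    (fun i ↦ le_sup_left (a := spanWithOne K ξ) (apply_mem_spanWithOne ξ i)) (fun i ↦ by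
      have := (spanWithOne K ξ ⊔ spanWithOne K υ).add_mem
        (le_sup_left (a := spanWithOne K ξ) (apply_mem_spanWithOne ξ i))
        (le_sup_right (b := spanWithOne K υ) (apply_mem_spanWithOne υ i))
      convert this using 1
      funext h
      simp [υ])
  have := card_le_of_linearIndependent hw hstep hwU
  rw [hnN] at this
  simpa using this

end GridPoints

section Counting

theorem card_filter_cast_eq_le (p H : ℕ) [NeZero p] (r : ZMod p) :
    ((Finset.Icc (-H : ℤ) H).filter fun x : ℤ ↦ (x : ZMod p) = r).card ≤ 2 * H / p + 1 := by
  have hp : (0 : ℤ) < p := by exact_mod_cast NeZero.pos p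
  have h := Finset.card_le_card_of_injOn
    (s := (Finset.Icc (-H : ℤ) H).filter fun x : ℤ ↦ (x : ZMod p) = r)
    (t := Finset.Icc (0 : ℤ) ((2 * H / p : ℕ) : ℤ)) (fun x : ℤ ↦ (x + H) / p) ?_ ?_
  · rwa [Int.card_Icc, sub_zero, ← Nat.cast_succ, Int.toNat_natCast] at h
  · intro x hx
    simp only [Finset.coe_filter, Finset.mem_Icc, Set.mem_ofPred_eq] at hx
    simp only [Finset.coe_Icc, Set.mem_Icc]
    refine ⟨Int.ediv_nonneg (by omega) hp.le, ?_⟩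
    push_cast
    exact Int.ediv_le_ediv hp (by omega)
  · intro x hx y hy hxy
    simp only [Finset.coe_filter, Finset.mem_Icc, Set.mem_ofPred_eq] at hx hy
    have hmod : (x + H) % p = (y + H) % p := by
      refine (ZMod.intCast_eq_intCast_iff' _ _ _).mp ?_
      push_cast
      rw [hx.2, hy.2]
    have h1 := Int.emod_add_mul_ediv (x + H) p
    have h2 := Int.emod_add_mul_ediv (y + H) p
    simp only at hxy
    rw [hmod, hxy, h2] at h1
    omega

theorem card_filter_residue_mem_le (n p H : ℕ) [NeZero p] (S : Finset (Fin n → ZMod p)) :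
    ((Fintype.piFinset fun _ : Fin n ↦ Finset.Icc (-H : ℤ) H).filter
      fun h : Fin n → ℤ ↦ (fun i ↦ (h i : ZMod p)) ∈ S).card ≤ S.card * (2 * H / p + 1) ^ n := by
  rw [mul_comm]
  refine Finset.card_le_mul_card_image_of_maps_to (t := S)
    (f := fun (h : Fin n → ℤ) i ↦ (h i : ZMod p)) (fun h hh ↦ (Finset.mem_filter.mp hh).2) _ fun r _ ↦ ?_
  calc _ ≤ (Fintype.piFinset fun i ↦
        (Finset.Icc (-H : ℤ) H).filter fun x : ℤ ↦ (x : ZMod p) = r i).card := by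
        refine Finset.card_le_card fun h hh ↦ ?_
        simp only [Finset.mem_filter, Fintype.mem_piFinset] at hh ⊢
        exact fun i ↦ ⟨hh.1.1 i, congrFun hh.2 i⟩
    _ ≤ ∏ _i : Fin n, (2 * H / p + 1) := by
        rw [Fintype.card_piFinset]
        exact Finset.prod_le_prod' fun i _ ↦ card_filter_cast_eq_le p H (r i)
    _ = _ := by simp

theorem cast_mul_pow_le {n s H p b A C₁ : ℕ} (hsn : s ≤ n) (hH : 0 < H) (hp : 0 < p)
    (hbH : b ≤ 2 * H + 1) (hbp : b ≤ p) (hA : A ≤ C₁ * b ^ (n - s)) :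
    ((A * (2 * H / p + 1) ^ n : ℕ) : ℝ) ≤
      C₁ * 4 ^ n * ((H : ℝ) ^ (n - s) + (H : ℝ) ^ n * (p : ℝ) ^ (-(s : ℝ))) := by
  have hp' : (0 : ℝ) < p := by exact_mod_cast hp
  have hH' : (0 : ℝ) < H := by exact_mod_cast hH
  have hA' : (A : ℝ) ≤ C₁ * (b : ℝ) ^ (n - s) := by exact_mod_cast hA
  rw [Real.rpow_neg hp'.le, Real.rpow_natCast]
  by_cases hHp : 2 * H < p
  · have hb : (b : ℝ) ≤ 4 * H := by
      have : b ≤ 4 * H := by omega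
      exact_mod_cast this
    rw [Nat.div_eq_of_lt hHp, zero_add, one_pow, mul_one]
    calc (A : ℝ) ≤ C₁ * (4 * H) ^ (n - s) := hA'.trans (by gcongr)
      _ = C₁ * 4 ^ (n - s) * (H : ℝ) ^ (n - s) := by rw [mul_pow, mul_assoc]
      _ ≤ C₁ * 4 ^ n * (H : ℝ) ^ (n - s) := by
        gcongr
        · norm_num
        · omega
      _ ≤ _ := by
        gcongr
        simp only [le_add_iff_nonneg_right]
        positivity
  · have hq : (((2 * H / p + 1 : ℕ)) : ℝ) ≤ 4 * H / p := by
      rw [le_div_iff₀ hp']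
      have h1 := Nat.div_mul_le_self (2 * H) p
      have : (2 * H / p + 1) * p ≤ 4 * H := by
        rw [add_mul]
        omega
      exact_mod_cast this
    push_cast at hq ⊢
    calc (A : ℝ) * (((2 * H / p : ℕ) : ℝ) + 1) ^ n
        ≤ C₁ * (p : ℝ) ^ (n - s) * (4 * H / p) ^ n := by
          have hb : (b : ℝ) ≤ p := by exact_mod_cast hbp
          gcongr
          exact hA'.trans (by gcongr)
      _ = C₁ * 4 ^ n * ((H : ℝ) ^ n * ((p : ℝ) ^ s)⁻¹) := by
          have h1 : (p : ℝ) ^ n = p ^ (n - s) * p ^ s := by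
            rw [← pow_add, Nat.sub_add_cancel hsn]
          rw [div_pow, mul_pow, h1]
          field_simp
      _ ≤ _ := by
        gcongr
        simp only [le_add_iff_nonneg_left]
        positivity

theorem cast_two_mul_add_one_pow_le {n s H p d : ℕ} (hsn : s ≤ n) (hH : 0 < H) (hp : 0 < p)
    (hpd : p ≤ d) :
    (((2 * H + 1) ^ n : ℕ) : ℝ) ≤
      (3 * d) ^ n * ((H : ℝ) ^ (n - s) + (H : ℝ) ^ n * (p : ℝ) ^ (-(s : ℝ))) := by
  have hp' : (0 : ℝ) < p := by exact_mod_cast hp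
  rw [Real.rpow_neg hp'.le, Real.rpow_natCast]
  have hH' : (2 * H + 1 : ℝ) ≤ 3 * H := by
    have : 2 * H + 1 ≤ 3 * H := by omega
    exact_mod_cast this
  have hps : (p : ℝ) ^ s ≤ (d : ℝ) ^ n := by
    have : p ^ s ≤ d ^ n :=
      (Nat.pow_le_pow_left hpd s).trans (Nat.pow_le_pow_right (by omega) hsn)
    exact_mod_cast this
  have h1 : 1 ≤ (d : ℝ) ^ n * ((p : ℝ) ^ s)⁻¹ := by
    rw [← div_eq_mul_inv, one_le_div (by positivity)]
    exact hps
  push_cast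
  calc (2 * H + 1 : ℝ) ^ n ≤ (3 * H) ^ n * 1 := by
        rw [mul_one]
        gcongr
    _ ≤ (3 * H) ^ n * ((d : ℝ) ^ n * ((p : ℝ) ^ s)⁻¹) := by gcongr
    _ = (3 * d) ^ n * ((H : ℝ) ^ n * ((p : ℝ) ^ s)⁻¹) := by
        rw [mul_pow, mul_pow]
        ring
    _ ≤ _ := by
        gcongr
        simp only [le_add_iff_nonneg_left]
        positivity

end Counting

/-- The ideal generated by `h·∇F` and its first partial derivatives. -/
noncomputable def singularIdeal {K : Type*} [Field K] {n : ℕ} (F : MvPolynomial (Fin n) K)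
    (h : Fin n → K) : Ideal (MvPolynomial (Fin n) K) :=
  Ideal.span (insert (∑ i, C (h i) * pderiv i F)
    (Set.range fun j ↦ pderiv j (∑ i, C (h i) * pderiv i F)))

theorem sum_C_mul_pderiv_pderiv_mem_singularIdeal {K : Type*} [Field K] {n : ℕ}
    (F : MvPolynomial (Fin n) K) (h : Fin n → K) (j : Fin n) :
    ∑ i, C (h i) * pderiv j (pderiv i F) ∈ singularIdeal F h := by
  have : pderiv j (∑ i, C (h i) * pderiv i F) ∈ singularIdeal F h :=
    Ideal.subset_span (Set.mem_insert_of_mem _ ⟨j, rfl⟩)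
  simpa [pderiv_C_mul, smul_eq_C_mul] using this

theorem card_le_of_le_ringKrullDim_singularIdeal {K : Type*} [Field K] [IsAlgClosed K] {n d : ℕ}
    (hn : 1 ≤ n) (hd : 2 ≤ d) (hdK : ((d - 1 : ℕ) : K) ≠ 0) {F : MvPolynomial (Fin n) K}
    (hF : F.IsHomogeneous d)
    (hzero : ∀ x : Fin n → K, (∀ j, aeval x (pderiv j F) = 0) → x = 0)
    {B : Finset K} (hB : B.Nonempty) {S : Finset (Fin n → K)} (hSB : ∀ h ∈ S, ∀ i, h i ∈ B)
    {s : ℕ} (hsn : s ≤ n)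
    (hS : ∀ h ∈ S,
      (s : WithBot ℕ∞) ≤ ringKrullDim (MvPolynomial (Fin n) K ⧸ singularIdeal F h)) :
    S.card ≤ (n * (n * (d - 1) + 1) ^ n) ^ n * (5 * n) ^ n * B.card ^ (n - s) := by
  have h := card_mul_pow_le hn hd hdK hF hzero hSB (singularIdeal F)
    (fun h _ j ↦ sum_C_mul_pderiv_pderiv_mem_singularIdeal F h j) hsn fun h hh ↦ by
      refine exists_algebraicIndependent_of_le_ringKrullDim
        (x := fun i ↦ Ideal.Quotient.mkₐ K (singularIdeal F h) (X i)) ?_ (hS h hh)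
      have := Set.range_comp (Ideal.Quotient.mkₐ K (singularIdeal F h)) X
      rw [Function.comp_def] at this
      rw [this, Algebra.adjoin_image, adjoin_range_X, Algebra.map_top, AlgHom.range_eq_top]
      exact Ideal.Quotient.mkₐ_surjective K _
  have hb : 1 ≤ B.card := hB.card_pos
  have hnb : 1 ≤ n * B.card := Nat.mul_pos hn hb
  refine Nat.le_of_mul_le_mul_right ?_ (Nat.pow_pos (n := s) hb)
  calc S.card * B.card ^ s
      ≤ (n * (n * (d - 1) + 1) ^ n) ^ n * (2 * (2 * n * B.card) + 1) ^ n := h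
    _ ≤ (n * (n * (d - 1) + 1) ^ n) ^ n * (5 * n * B.card) ^ n :=
        Nat.mul_le_mul_left _ (Nat.pow_le_pow_left (by nlinarith) n)
    _ = (n * (n * (d - 1) + 1) ^ n) ^ n * (5 * n) ^ n * (B.card ^ (n - s) * B.card ^ s) := by
        rw [← pow_add, Nat.sub_add_cancel hsn, mul_pow (5 * n), mul_assoc]
    _ = _ := by ring

theorem map_span_eq_singularIdeal {k K : Type*} [Field k] [Field K] [Algebra k K] {n : ℕ}
    (F : MvPolynomial (Fin n) k) (r : Fin n → k) :
    Ideal.span (insert (MvPolynomial.map (algebraMap k K) (∑ i, C (r i) * pderiv i F))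
      (Set.range fun j ↦ MvPolynomial.map (algebraMap k K)
        (pderiv j (∑ i, C (r i) * pderiv i F)))) =
    singularIdeal (MvPolynomial.map (algebraMap k K) F) fun i ↦ algebraMap k K (r i) := by
  simp only [singularIdeal, ← pderiv_map, map_sum, map_mul, map_C]

/-- A bound for the number of integer vectors `h` in a box for which the singular locus of
`h·∇F = 0` has dimension at least `s`. -/
theorem card_filter_le_of_le_ringKrullDim {K : Type*} [Field K] [IsAlgClosed K] {n d p : ℕ}
    [Fact p.Prime] [Algebra (ZMod p) K] (hn : 1 ≤ n) (hd : 2 ≤ d)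
    {F : MvPolynomial (Fin n) (ZMod p)} (hF : F.IsHomogeneous d)
    (hzero : ∀ x : Fin n → K, (∀ j, aeval x (pderiv j F) = 0) → x = 0)
    {H : ℕ} (hH : 0 < H) {s : ℕ} (hsn : s ≤ n) {T : Finset (Fin n → ℤ)}
    (hTH : T ⊆ Fintype.piFinset fun _ : Fin n ↦ Finset.Icc (-H : ℤ) H)
    (hT : ∀ h ∈ T, (s : WithBot ℕ∞) ≤ ringKrullDim (MvPolynomial (Fin n) K ⧸
      singularIdeal (MvPolynomial.map (algebraMap (ZMod p) K) F)
        fun i ↦ algebraMap (ZMod p) K (h i : ZMod p))) :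
    (T.card : ℝ) ≤
      ((3 * d) ^ n + ((n * (n * (d - 1) + 1) ^ n) ^ n * (5 * n) ^ n : ℕ) * 4 ^ n) *
        ((H : ℝ) ^ (n - s) + (H : ℝ) ^ n * (p : ℝ) ^ (-(s : ℝ))) := by
  classical
  have hp : 0 < p := (Fact.out : p.Prime).pos
  rw [add_mul]
  by_cases hdp : ((d - 1 : ℕ) : K) = 0
  · have hpd : p ≤ d := by
      have : CharP K p := charP_of_injective_algebraMap (algebraMap (ZMod p) K).injective p
      have := Nat.le_of_dvd (by omega) ((CharP.cast_eq_zero_iff K p _).mp hdp)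
      omega
    have hT : T.card ≤ (2 * H + 1) ^ n := by
      refine (Finset.card_le_card hTH).trans ?_
      rw [Fintype.card_piFinset_const, Int.card_Icc]
      exact Nat.pow_le_pow_left (by omega) _
    refine le_add_of_le_of_nonneg ?_ (by positivity)
    exact (Nat.cast_le.mpr hT).trans (cast_two_mul_add_one_pow_le hsn hH hp hpd)
  · let S₀ : Finset (Fin n → ZMod p) := T.image fun (h : Fin n → ℤ) i ↦ (h i : ZMod p)
    let S : Finset (Fin n → K) := S₀.image fun r i ↦ algebraMap (ZMod p) K (r i)
    let B : Finset K :=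
      ((Finset.Icc (-H : ℤ) H).image fun x : ℤ ↦ (x : ZMod p)).image (algebraMap (ZMod p) K)
    have hinj : Function.Injective fun (r : Fin n → ZMod p) i ↦ algebraMap (ZMod p) K (r i) :=
      (algebraMap (ZMod p) K).injective.comp_left
    have hBH : B.card ≤ 2 * H + 1 := by
      refine Finset.card_image_le.trans (Finset.card_image_le.trans ?_)
      rw [Int.card_Icc]
      omega
    have hBp : B.card ≤ p := by
      refine Finset.card_image_le.trans ((Finset.card_le_univ _).trans ?_)
      rw [ZMod.card]
    have hB : B.Nonempty := by
      refine ((Finset.nonempty_Icc.mpr ?_).image _).image _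
      omega
    have hSB : ∀ h ∈ S, ∀ i, h i ∈ B := by
      simp only [S, S₀, Finset.mem_image]
      rintro _ ⟨_, ⟨h, hh, rfl⟩, rfl⟩ i
      exact Finset.mem_image_of_mem _
        (Finset.mem_image_of_mem _ (Fintype.mem_piFinset.mp (hTH hh) i))
    have hS : S.card ≤ (n * (n * (d - 1) + 1) ^ n) ^ n * (5 * n) ^ n * B.card ^ (n - s) := by
      refine card_le_of_le_ringKrullDim_singularIdeal hn hd hdp
        (hF.map (algebraMap (ZMod p) K)) ?_ hB hSB hsn ?_
      · intro x hx
        refine hzero x fun j ↦ ?_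
        rw [← hx j, pderiv_map, aeval_map_algebraMap]
      · simp only [S, S₀, Finset.mem_image]
        rintro _ ⟨_, ⟨h, hh, rfl⟩, rfl⟩
        exact hT h hh
    rw [Finset.card_image_of_injective _ hinj] at hS
    have hTS : T.card ≤ S₀.card * (2 * H / p + 1) ^ n := by
      refine le_trans (Finset.card_le_card fun h hh ↦ ?_)
        (card_filter_residue_mem_le n p H S₀)
      exact Finset.mem_filter.mpr ⟨hTH hh, Finset.mem_image_of_mem _ hh⟩
    refine le_add_of_nonneg_of_le (by positivity) ?_
    exact (Nat.cast_le.mpr hTS).trans (cast_mul_pow_le hsn hH hp hBH hBp hS)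

theorem stmt10 (n d : ℕ) (hn : 1 ≤ n) (hd : 2 ≤ d) :
    ∃ C : ℝ, ∀ (p : ℕ) [Fact p.Prime] (F : MvPolynomial (Fin n) (ZMod p)),
      F.IsHomogeneous d →
      -- F is nonsingular
      (∀ x : Fin n → AlgebraicClosure (ZMod p),
        (∀ i : Fin n, MvPolynomial.aeval x (MvPolynomial.pderiv i F) = 0) → x = 0) →
      ∀ (H : ℕ), 0 < H → ∀ s : ℕ, s ≤ n →
      (Set.ncard {h : Fin n → ℤ | h ≠ 0 ∧ (∀ i, |h i| ≤ (H : ℤ)) ∧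
          ringKrullDim (MvPolynomial (Fin n) (AlgebraicClosure (ZMod p)) ⧸ Ideal.span
            (insert (MvPolynomial.map (algebraMap (ZMod p) (AlgebraicClosure (ZMod p)))
                (∑ i, MvPolynomial.C ((h i : ZMod p)) * MvPolynomial.pderiv i F))
              (Set.range (fun j : Fin n =>
                MvPolynomial.map (algebraMap (ZMod p) (AlgebraicClosure (ZMod p)))
                  (MvPolynomial.pderiv j
                    (∑ i, MvPolynomial.C ((h i : ZMod p)) * MvPolynomial.pderiv i F))))))
            = (s : WithBot (WithTop ℕ))} : ℝ) ≤
        C * ((H : ℝ) ^ (n - s) + (H : ℝ) ^ n * (p : ℝ) ^ (-(s : ℝ))) := by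
  refine ⟨(3 * d) ^ n + ((n * (n * (d - 1) + 1) ^ n) ^ n * (5 * n) ^ n : ℕ) * 4 ^ n,
    fun p _ F hF hzero H hH s hsn ↦ ?_⟩
  generalize hA : {h : Fin n → ℤ | _} = A
  have hAbox : A ⊆ (Fintype.piFinset fun _ : Fin n ↦ Finset.Icc (-H : ℤ) H : Finset _) := by
    rw [← hA]
    rintro h ⟨-, hh, -⟩
    exact Finset.mem_coe.mpr
      (Fintype.mem_piFinset.mpr fun i ↦ Finset.mem_Icc.mpr (abs_le.mp (hh i)))
  have hAfin : A.Finite := (Finset.finite_toSet _).subset hAbox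
  rw [Set.ncard_eq_toFinset_card A hAfin]
  refine card_filter_le_of_le_ringKrullDim hn hd hF hzero hH hsn
    (fun h hh ↦ hAbox (hAfin.mem_toFinset.mp hh)) fun h hh ↦ ?_
  rw [hAfin.mem_toFinset, ← hA] at hh
  have hdim : ringKrullDim _ = (s : WithBot ℕ∞) := hh.2.2
  rw [map_span_eq_singularIdeal] at hdim
  exact hdim.ge
end

section
/- Let n ≥ 2 and d ≥ 3 be integers. There is a constant C depending only on n and d with the following property. Let q be either a prime or a product p₁p₂ of primes with p₁ < p₂ < 2p₁, and suppose every prime divisor of q exceeds C. Let h, g ∈ ℤ[x₁,…,xₙ] with deg h ≤ deg g = d and leading form G of g, such that either the leading form of h is an integer multiple of G or deg h < d, and such that for every prime divisor ℓ of q: the reduction of G modulo ℓ is nonsingular; the unique γ_ℓ ∈ 𝔽_ℓ with deg(h − γ_ℓ·g) < d over 𝔽_ℓ yields a leading form H_ℓ of h − γ_ℓ·g of degree at least 2; and s(h,g;ℓ) denotes the dimension of the singular locus of the affine variety H_ℓ = 0. Then there is a matrix M ∈ SL_n(ℤ) whose entries all have absolute value at most C such that for every prime divisor ℓ of q: (a)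 the (n−1)-variable form G_M(y₁,…,y_{n−1}, 0), where G_M(x) = G(Mx), is nonsingular modulo ℓ; and (b) the (n−1)-variable form (H_ℓ)_M(y₁,…,y_{n−1}, 0) has degree at least 2 over 𝔽_ℓ and the singular locus of its zero set in affine (n−1)-space has dimension at most max(s(h,g;ℓ) − 1, 0). -/
open MvPolynomial

/-- The leading form of a multivariate polynomial: its homogeneous component in degree equal
to its total degree. -/
noncomputable def LeadForm {n : ℕ} {R : Type} [CommRing R] (f : MvPolynomial (Fin n) R) :
    MvPolynomial (Fin n) R :=
  MvPolynomial.homogeneousComponent f.totalDegree f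

/-- A polynomial over `𝔽_ℓ = ZMod ℓ` in `m` variables is nonsingular: over any algebraic
closure of `𝔽_ℓ`, the only common zero of its partial derivatives is the origin. -/
def NonsingularOverFp (ℓ : ℕ) {m : ℕ} (F : MvPolynomial (Fin m) (ZMod ℓ)) : Prop :=
  ∀ (K : Type) [Field K] [Algebra (ZMod ℓ) K],
    IsAlgClosed K → Algebra.IsAlgebraic (ZMod ℓ) K →
    ∀ x : Fin m → K,
      (∀ i : Fin m, MvPolynomial.aeval x (MvPolynomial.pderiv i F) = 0) → x = 0

/-- The ideal of the singular locus of the affine variety `Hf = 0` over `K`. -/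
noncomputable def singIdeal {m : ℕ} (ℓ : ℕ) (K : Type) [Field K] [Algebra (ZMod ℓ) K]
    (Hf : MvPolynomial (Fin m) (ZMod ℓ)) : Ideal (MvPolynomial (Fin m) K) :=
  Ideal.span (insert (MvPolynomial.map (algebraMap (ZMod ℓ) K) Hf)
    (Set.range (fun i : Fin m =>
      MvPolynomial.map (algebraMap (ZMod ℓ) K) (MvPolynomial.pderiv i Hf))))

/-- The singular locus of the affine variety `Hf = 0` over an algebraic closure of `𝔽_ℓ`
has dimension exactly `s`. -/
def SingLocusDimEq (ℓ : ℕ) {m : ℕ} (Hf : MvPolynomial (Fin m) (ZMod ℓ)) (s : ℕ) : Prop :=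
  ∀ (K : Type) [Field K] [Algebra (ZMod ℓ) K],
    IsAlgClosed K → Algebra.IsAlgebraic (ZMod ℓ) K →
    ringKrullDim (MvPolynomial (Fin m) K ⧸ singIdeal ℓ K Hf) = (s : WithBot (WithTop ℕ))

/-- The singular locus of the affine variety `Hf = 0` over an algebraic closure of `𝔽_ℓ`
has dimension at most `t`. -/
def SingLocusDimLe (ℓ : ℕ) {m : ℕ} (Hf : MvPolynomial (Fin m) (ZMod ℓ)) (t : ℕ) : Prop :=
  ∀ (K : Type) [Field K] [Algebra (ZMod ℓ) K],
    IsAlgClosed K → Algebra.IsAlgebraic (ZMod ℓ) K →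
    ringKrullDim (MvPolynomial (Fin m) K ⧸ singIdeal ℓ K Hf) ≤ (t : WithBot (WithTop ℕ))

/-- For `M ∈ SL_n(ℤ)` and `f` a polynomial in `n` variables over `R`,
the polynomial `f_M(y₁,…,y_{n-1},0) = f(M·(y,0))` in `n-1` variables. -/
noncomputable def SubstZero {n : ℕ} {R : Type} [CommRing R]
    (M : Matrix (Fin n) (Fin n) ℤ) (f : MvPolynomial (Fin n) R) :
    MvPolynomial (Fin (n - 1)) R :=
  MvPolynomial.aeval (fun i : Fin n => ∑ j : Fin n,
    MvPolynomial.C ((M i j : ℤ) : R) *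
      (if hj : (j : ℕ) < n - 1 then MvPolynomial.X (⟨(j : ℕ), hj⟩ : Fin (n - 1)) else 0)) f

/-- Reduction of an integer polynomial modulo `ℓ`. -/
noncomputable def redMod (ℓ : ℕ) {n : ℕ} (f : MvPolynomial (Fin n) ℤ) :
    MvPolynomial (Fin n) (ZMod ℓ) :=
  MvPolynomial.map (Int.castRingHom (ZMod ℓ)) f

/-- If a finite set of polynomials over an algebraically closed field has no common zero other than
possibly the origin, all monomials of large degree lie in the ideal they span. -/
theorem exists_monomial_mem_span_of_forall_zero {K ι : Type*} [Field K] [IsAlgClosed K] {m : ℕ}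
    (F : ι → MvPolynomial (Fin m) K)
    (hF : ∀ x : Fin m → K, (∀ i, eval x (F i) = 0) → x = 0) :
    ∃ N : ℕ, ∀ u : Fin m →₀ ℕ, N ≤ u.degree →
      monomial u (1 : K) ∈ Ideal.span (Set.range F) := by
  have hle : idealOfVars (Fin m) K ≤ (Ideal.span (Set.range F)).radical := by
    rw [← vanishingIdeal_zeroLocus_eq_radical (k := K) (K := K), idealOfVars, Ideal.span_le]
    rintro _ ⟨i, rfl⟩
    rw [SetLike.mem_coe, mem_vanishingIdeal_iff]
    intro x hx
    have : x = 0 := hF x fun j => by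
      simpa [aeval_eq_eval] using hx (F j) (Ideal.subset_span ⟨j, rfl⟩)
    simp [this]
  obtain ⟨N, hN⟩ := Ideal.exists_pow_le_of_le_radical_of_fg hle (idealOfVars_fg (Fin m) K)
  refine ⟨N, fun u hu => hN ?_⟩
  rw [mem_pow_idealOfVars_iff']
  intro v hv
  rw [coeff_monomial, if_neg]
  rintro rfl
  omega

/-- A submodule of `S → A` whose image under a ring homomorphism to a field spans contains a
multiple of every standard basis vector, by a factor not killed by the homomorphism. -/
theorem exists_smul_single_mem_of_span_eq_top {A K S : Type*} [CommRing A] [Field K] [Fintype S]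
    [DecidableEq S] (φ : A →+* K) (W : Submodule A (S → A))
    (hW : Submodule.span K ((fun w : S → A => fun s => φ (w s)) '' (W : Set (S → A))) = ⊤) :
    ∃ r : A, φ r ≠ 0 ∧ ∀ s : S, Pi.single s r ∈ W := by
  classical
  let b := Module.Basis.ofSpan hW.ge
  have hb : ∀ i, ∃ w ∈ W, (fun s => φ (w s)) = b i := fun i =>
    Module.Basis.ofSpan_subset hW.ge (Set.mem_range_self i)
  let e := b.indexEquiv (Pi.basisFun K S)
  let b' := b.reindex e
  choose w hw hwb using hb
  let B : Matrix S S A := Matrix.of fun i => w (e.symm i)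
  have hdet : φ B.det ≠ 0 := by
    have h1 : φ B.det = (Matrix.of fun i => b' i).det := by
      rw [RingHom.map_det]
      congr 1
      ext i s
      simp only [RingHom.mapMatrix_apply, Matrix.map_apply, Matrix.of_apply, B]
      rw [show b' i = b (e.symm i) from by simp [b'], ← hwb]
    rw [h1]
    have h2 := (Pi.basisFun K S).isUnit_det b'
    rw [Module.Basis.det_apply] at h2
    rw [← Matrix.det_transpose]
    convert h2.ne_zero using 2
    ext i s
    simp [Module.Basis.toMatrix_apply]
  refine ⟨B.det, hdet, fun s => ?_⟩
  have h3 : Pi.single s B.det = ∑ i, B.adjugate s i • B i := by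
    have := B.adjugate_mul
    ext t
    have h4 := congrFun (congrFun this s) t
    simp only [Matrix.mul_apply, Matrix.smul_apply, Matrix.one_apply, smul_eq_mul] at h4
    simp only [Finset.sum_apply, Pi.smul_apply, smul_eq_mul, h4, Pi.single_apply, mul_ite, mul_one,
      mul_zero, eq_comm]
  rw [h3]
  exact W.sum_mem fun i _ => W.smul_mem _ (hw _)

/-- If homogeneous polynomials over `A` have no common zero other than the origin after base change
along `φ : A →+* K`, some `r : A` with `φ r ≠ 0` witnesses this. -/
theorem exists_C_mul_X_pow_mem_span {A K ι : Type*} [CommRing A] [Field K] [IsAlgClosed K]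
    [Fintype ι] {m : ℕ} (F : ι → MvPolynomial (Fin m) A) (e : ι → ℕ)
    (he : ∀ i, (F i).IsHomogeneous (e i)) (φ : A →+* K)
    (hF : ∀ x : Fin m → K, (∀ i, eval₂ φ x (F i) = 0) → x = 0) :
    ∃ r : A, φ r ≠ 0 ∧ ∃ N : ℕ, ∀ i, C r * X i ^ N ∈ Ideal.span (Set.range F) := by
  classical
  obtain ⟨N, hN⟩ := exists_monomial_mem_span_of_forall_zero (fun i => map φ (F i))
    (fun x hx => hF x fun i => by simpa [eval_map] using hx i)
  let S := {u : Fin m →₀ ℕ // u ∈ Finset.finsuppAntidiag (Finset.univ : Finset (Fin m)) N}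
  have hS : ∀ u : Fin m →₀ ℕ,
      u ∈ Finset.finsuppAntidiag (Finset.univ : Finset (Fin m)) N ↔ u.degree = N := fun u => by
    simp [Finset.mem_finsuppAntidiag, Finsupp.degree_eq_sum]
  let P : (S → A) →ₗ[A] MvPolynomial (Fin m) A :=
    ∑ s : S, (monomial s.1).comp (LinearMap.proj (R := A) (φ := fun _ : S => A) s)
  let W : Submodule A (S → A) := ((Ideal.span (Set.range F)).restrictScalars A).comap P
  have hP : ∀ f : MvPolynomial (Fin m) A, f.IsHomogeneous N → P (fun s => coeff s.1 f) = f := by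
    intro f hf
    ext u
    simp only [P, LinearMap.sum_apply, LinearMap.comp_apply, LinearMap.proj_apply, coeff_sum,
      coeff_monomial]
    by_cases hu : u.degree = N
    · rw [Finset.sum_eq_single (⟨u, (hS u).2 hu⟩ : S)]
      · simp
      · rintro ⟨v, hv⟩ - hne
        rw [if_neg]
        rintro rfl
        exact hne rfl
      · simp
    · rw [hf.coeff_eq_zero hu]
      refine Finset.sum_eq_zero fun s _ => ?_
      rw [if_neg]
      rintro rfl
      exact hu ((hS _).1 s.2)
  let T : MvPolynomial (Fin m) K →ₗ[K] (S → K) := LinearMap.pi fun s => lcoeff K s.1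
  have hT : ∀ f ∈ Ideal.span (Set.range fun i => map φ (F i)),
      T f ∈ Submodule.span K ((fun w : S → A => fun s => φ (w s)) '' (W : Set (S → A))) := by
    intro f hf
    obtain ⟨g, rfl⟩ := Ideal.mem_span_range_iff_exists_fun.1 hf
    rw [map_sum]
    refine Submodule.sum_mem _ fun i _ => ?_
    induction g i using MvPolynomial.induction_on' with
    | add p q hp hq =>
      rw [add_mul, map_add]
      exact Submodule.add_mem _ hp hq
    | monomial u a =>
      have h1 : T (monomial u a * map φ (F i)) =
          a • fun s : S => φ (coeff s.1 (monomial u 1 * F i)) := by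
        have h0 : monomial u a * map φ (F i) = a • map φ (monomial u 1 * F i) := by
          rw [map_mul, map_monomial, map_one, ← smul_mul_assoc, smul_monomial, smul_eq_mul,
            mul_one]
        rw [h0]
        ext s
        simp only [T, LinearMap.pi_apply, lcoeff_apply, coeff_smul, coeff_map, Pi.smul_apply]
      have hhom : (monomial u (1 : A) * F i).IsHomogeneous (u.degree + e i) :=
        (isHomogeneous_monomial 1 rfl).mul (he i)
      rw [h1]
      refine Submodule.smul_mem _ _ ?_
      by_cases hu : u.degree + e i = N
      · refine Submodule.subset_span ⟨fun s => coeff s.1 (monomial u 1 * F i), ?_, rfl⟩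
        change P _ ∈ Ideal.span (Set.range F)
        rw [hP _ (hu ▸ hhom)]
        exact Ideal.mul_mem_left _ _ (Ideal.subset_span ⟨i, rfl⟩)
      · convert Submodule.zero_mem _
        rename_i s
        rw [hhom.coeff_eq_zero, map_zero, Pi.zero_apply]
        rw [(hS _).1 s.2]
        exact Ne.symm hu
  have htop : Submodule.span K ((fun w : S → A => fun s => φ (w s)) '' (W : Set (S → A))) = ⊤ := by
    rw [eq_top_iff, ← (Pi.basisFun K S).span_eq, Submodule.span_le]
    rintro _ ⟨s, rfl⟩
    have hs : Pi.basisFun K S s = T (monomial s.1 1) := by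
      ext t
      rw [Pi.basisFun_apply]
      rcases eq_or_ne t s with rfl | h
      · simp [T]
      · have h' : s.1 ≠ t.1 := fun h' => h (Subtype.ext h'.symm)
        simp [T, coeff_monomial, h, h']
    rw [hs]
    exact hT _ (hN s.1 ((hS _).1 s.2).ge)
  obtain ⟨r, hr, hW⟩ := exists_smul_single_mem_of_span_eq_top φ W htop
  refine ⟨r, hr, N, fun i => ?_⟩
  have hi : (Finsupp.single i N).degree = N := by simp
  have h := hW ⟨_, (hS _).2 hi⟩
  have h2 : P (Pi.single (⟨_, (hS _).2 hi⟩ : S) r) = C r * X i ^ N := by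
    simp only [P, LinearMap.sum_apply, LinearMap.comp_apply, LinearMap.proj_apply]
    rw [Finset.sum_eq_single (⟨_, (hS _).2 hi⟩ : S)]
    · simp [← C_mul_X_pow_eq_monomial]
    · intro b _ hb
      simp [hb]
    · simp
  rw [← h2]
  exact h

theorem eq_zero_of_C_mul_X_pow_mem_span {A K ι : Type*} [CommRing A] [Field K] {m : ℕ}
    (F : ι → MvPolynomial (Fin m) A) (φ : A →+* K) {r : A} (hr : φ r ≠ 0) {N : ℕ}
    (h : ∀ i, C r * X i ^ N ∈ Ideal.span (Set.range F)) (x : Fin m → K)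
    (hx : ∀ i, eval₂ φ x (F i) = 0) : x = 0 := by
  have hle : Ideal.span (Set.range F) ≤ RingHom.ker (eval₂Hom φ x) := by
    rw [Ideal.span_le]
    rintro _ ⟨i, rfl⟩
    simpa using hx i
  funext i
  have h1 := hle (h i)
  simp only [RingHom.mem_ker, map_mul, map_pow, coe_eval₂Hom, eval₂_C, eval₂_X, mul_eq_zero,
    hr, false_or] at h1
  exact eq_zero_of_pow_eq_zero h1

theorem totalDegree_eval₂_le {R S σ τ : Type*} [CommSemiring R] [CommSemiring S]
    (f : R →+* MvPolynomial τ S) (hf : ∀ r, (f r).totalDegree = 0) (g : σ → MvPolynomial τ S)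
    (hg : ∀ s, (g s).totalDegree ≤ 1) (p : MvPolynomial σ R) :
    (eval₂ f g p).totalDegree ≤ p.totalDegree := by
  rw [eval₂_eq]
  refine totalDegree_finsetSum_le fun u hu => ?_
  calc (f (coeff u p) * ∏ i ∈ u.support, g i ^ u i).totalDegree
      ≤ (f (coeff u p)).totalDegree + (∏ i ∈ u.support, g i ^ u i).totalDegree :=
        totalDegree_mul _ _
    _ ≤ 0 + ∑ i ∈ u.support, u i := by
        refine add_le_add (hf _).le ((totalDegree_finsetProd _ _).trans ?_)
        refine Finset.sum_le_sum fun i _ => (totalDegree_pow _ _).trans ?_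
        simpa using Nat.mul_le_mul_left (u i) (hg i)
    _ ≤ p.totalDegree := by
        rw [zero_add]
        exact le_totalDegree hu

/-- For a family of homogeneous polynomials depending on parameters `c` and `a`, there is a uniform
bound `D` such that, for fixed `c`, the condition that the members of the family have only the
trivial common zero is implied by the nonvanishing at `a` of a nonzero polynomial of degree at most
`D`, as soon as it holds for one `a`. -/
theorem exists_totalDegree_le_of_forall_zero {ι σ τ : Type*} [Fintype ι] [Finite σ] [Finite τ]
    {m : ℕ} (F : ι → MvPolynomial (Fin m) (MvPolynomial (σ ⊕ τ) ℤ)) (e : ι → ℕ)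
    (he : ∀ i, (F i).IsHomogeneous (e i)) :
    ∃ D : ℕ, ∀ (K : Type) [Field K] [IsAlgClosed K] (c : σ → K) (a₀ : τ → K),
      (∀ x : Fin m → K,
        (∀ i, eval₂ (eval₂Hom (Int.castRingHom K) (Sum.elim c a₀)) x (F i) = 0) → x = 0) →
      ∃ P : MvPolynomial τ K, P ≠ 0 ∧ P.totalDegree ≤ D ∧ ∀ a : τ → K, eval a P ≠ 0 →
        ∀ x : Fin m → K,
          (∀ i, eval₂ (eval₂Hom (Int.castRingHom K) (Sum.elim c a)) x (F i) = 0) → x = 0 := by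
  let R : Set (MvPolynomial (σ ⊕ τ) ℤ) :=
    {r | ∃ N : ℕ, ∀ i, C r * X i ^ N ∈ Ideal.span (Set.range F)}
  obtain ⟨S, hSR, hS⟩ := (Submodule.fg_span_iff_fg_span_finset_subset R).1
    (IsNoetherian.noetherian (Ideal.span R))
  refine ⟨S.sup totalDegree, fun K _ _ c a₀ h₀ => ?_⟩
  obtain ⟨r, hr, hrR⟩ := exists_C_mul_X_pow_mem_span F e he _ h₀
  obtain ⟨r', hr'S, hr'⟩ : ∃ r' ∈ S, eval₂Hom (Int.castRingHom K) (Sum.elim c a₀) r' ≠ 0 := by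
    by_contra! hcon
    refine hr ?_
    have hle : Submodule.span _ (S : Set (MvPolynomial (σ ⊕ τ) ℤ)) ≤
        RingHom.ker (eval₂Hom (Int.castRingHom K) (Sum.elim c a₀)) :=
      Submodule.span_le.2 fun r' hr' => hcon r' hr'
    exact hle (hS ▸ Submodule.subset_span hrR)
  let P : MvPolynomial τ K := eval₂ (C.comp (Int.castRingHom K)) (Sum.elim (fun i => C (c i)) X) r'
  have hP : ∀ a : τ → K, eval a P = eval₂Hom (Int.castRingHom K) (Sum.elim c a) r' := by
    intro a
    have h : (eval a).comp (eval₂Hom (C.comp (Int.castRingHom K)) (Sum.elim (fun i => C (c i)) X))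
        = eval₂Hom (Int.castRingHom K) (Sum.elim c a) := by
      refine ringHom_ext (fun r => by simp) ?_
      rintro (i | i) <;> simp
    exact RingHom.congr_fun h r'
  refine ⟨P, fun h => hr' ?_, ?_, fun a ha => ?_⟩
  · rw [← hP, h, map_zero]
  · refine (totalDegree_eval₂_le _ (fun r => ?_) _ ?_ r').trans (Finset.le_sup hr'S)
    · rw [RingHom.comp_apply]
      exact totalDegree_C _
    rintro (i | i)
    · simp
    · simp
  · obtain ⟨N, hN⟩ := hSR hr'S
    exact eq_zero_of_C_mul_X_pow_mem_span F _ (hP a ▸ ha) hN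

/-- Given a nonzero polynomial `h` in `n` variables and `n` further polynomials, some nontrivial
polynomial relation between the latter holds modulo `h`. -/
theorem exists_dvd_aeval {K : Type*} [Field K] {n : ℕ} (f : Fin n → MvPolynomial (Fin n) K)
    {h : MvPolynomial (Fin n) K} (hh : h ≠ 0) :
    ∃ P : MvPolynomial (Fin n) K, P ≠ 0 ∧ h ∣ aeval f P := by
  have hdep : ¬ AlgebraicIndependent K (fun o : Option (Fin n) => o.elim h f) := fun hind => by
    have := hind.lift_cardinalMk_le_trdeg
    rw [MvPolynomial.trdeg_of_isDomain] at this
    simp only [Cardinal.mk_fintype, Fintype.card_option, Fintype.card_fin, Cardinal.lift_natCast,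
      Nat.cast_le] at this
    omega
  rw [algebraicIndependent_iff] at hdep
  push Not at hdep
  obtain ⟨Q, hQ, hQ0⟩ := hdep
  let q := optionEquivLeft K (Fin n) Q
  have hq0 : q ≠ 0 := by simpa [q] using hQ0
  have hq : q.eval₂ (aeval f : _ →ₐ[K] _).toRingHom h = 0 := by
    have : ((Polynomial.eval₂RingHom (aeval f : _ →ₐ[K] MvPolynomial (Fin n) K).toRingHom h).comp
        (optionEquivLeft K (Fin n)).toRingHom) =
        (aeval (fun o : Option (Fin n) => o.elim h f) : _ →ₐ[K] _).toRingHom := by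
      refine ringHom_ext (fun r => ?_) ?_
      · simp [optionEquivLeft_C]
      · rintro (_ | i) <;> simp [optionEquivLeft_X_none, optionEquivLeft_X_some]
    exact (RingHom.congr_fun this Q).trans hQ
  obtain ⟨q', hq', hX⟩ := Polynomial.exists_eq_pow_rootMultiplicity_mul_and_not_dvd q hq0 0
  rw [map_zero, sub_zero, Polynomial.X_dvd_iff] at hX
  refine ⟨q'.coeff 0, hX, ?_⟩
  rw [hq', map_zero, sub_zero, Polynomial.eval₂_mul, Polynomial.eval₂_pow, Polynomial.eval₂_X,
    mul_eq_zero, or_iff_right (pow_ne_zero _ hh), ← Polynomial.divX_mul_X_add q',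
    Polynomial.eval₂_add, Polynomial.eval₂_mul, Polynomial.eval₂_X, Polynomial.eval₂_C] at hq
  have h' := eq_neg_of_add_eq_zero_right hq
  exact ⟨-_, by rw [mul_neg, mul_comm]; exact h'⟩

/-- The linear form with the given coefficients. -/
noncomputable def linForm {R : Type*} [CommSemiring R] {n : ℕ} (a : Fin n → R) :
    MvPolynomial (Fin n) R :=
  ∑ i, C (a i) * X i

theorem eval_linForm {R : Type*} [CommSemiring R] {n : ℕ} (a x : Fin n → R) :
    eval x (linForm a) = ∑ i, a i * x i := by
  simp [linForm]

theorem isHomogeneous_linForm {R : Type*} [CommSemiring R] {n : ℕ} (a : Fin n → R) :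
    (linForm a).IsHomogeneous 1 :=
  IsHomogeneous.sum _ _ _ fun i _ => isHomogeneous_C_mul_X (a i) i

theorem idealOfVars_isMaximal (K : Type*) [Field K] (n : ℕ) :
    (idealOfVars (Fin n) K).IsMaximal := by
  have h : idealOfVars (Fin n) K = RingHom.ker (constantCoeff : MvPolynomial (Fin n) K →+* K) := by
    ext f
    rw [← pow_one (idealOfVars (Fin n) K), mem_pow_idealOfVars_iff', RingHom.mem_ker]
    simp [Finsupp.degree_eq_zero_iff, constantCoeff_eq]
  rw [h]
  exact RingHom.ker_isMaximal_of_surjective _ fun r => ⟨C r, by simp⟩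

/-- Over an infinite field, a general linear form lies in none of finitely many ideals that do not
contain all the variables. -/
theorem exists_linForm_notMem {K : Type*} [Field K] [Infinite K] {n : ℕ}
    {S : Set (Ideal (MvPolynomial (Fin n) K))} (hfin : S.Finite)
    (hS : ∀ p ∈ S, ¬ idealOfVars (Fin n) K ≤ p) {Q : MvPolynomial (Fin n) K} (hQ : Q ≠ 0) :
    ∃ a : Fin n → K, eval a Q ≠ 0 ∧ ∀ p ∈ S, linForm a ∉ p := by
  classical
  have key : ∀ p ∈ S, ∃ q : MvPolynomial (Fin n) K, q ≠ 0 ∧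
      ∀ a, linForm a ∈ p → eval a q = 0 := by
    intro p hp
    let L : (Fin n → K) →ₗ[K] MvPolynomial (Fin n) K :=
      ∑ i, (LinearMap.toSpanSingleton K _ (X i)).comp (LinearMap.proj (φ := fun _ => K) i)
    have hL : ∀ a, L a = linForm a := fun a => by simp [L, linForm, smul_eq_C_mul]
    let W : Submodule K (Fin n → K) := (p.restrictScalars K).comap L
    have hW : W < ⊤ := by
      rw [lt_top_iff_ne_top]
      intro h
      refine hS p hp ?_
      rw [idealOfVars, Ideal.span_le]
      rintro _ ⟨i, rfl⟩
      have h1 : Pi.single i 1 ∈ W := h ▸ Submodule.mem_top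
      have h2 : linForm (Pi.single i 1) ∈ p := hL (Pi.single i 1) ▸ h1
      simpa [linForm, Pi.single_apply] using h2
    obtain ⟨f, hf, hle⟩ := Submodule.exists_le_ker_of_lt_top W hW
    have hfe : ∀ a, eval a (linForm fun i => f (Pi.single i 1)) = f a := fun a => by
      rw [eval_linForm, LinearMap.pi_apply_eq_sum_univ f a]
      refine Finset.sum_congr rfl fun i _ => ?_
      rw [smul_eq_mul, mul_comm]
      congr 2
      ext j
      simp [Pi.single_apply, eq_comm]
    refine ⟨linForm fun i => f (Pi.single i 1), fun h => hf ?_, fun a ha => ?_⟩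
    · refine LinearMap.ext fun a => ?_
      rw [← hfe, h, map_zero, LinearMap.zero_apply]
    · rw [hfe]
      refine hle ?_
      change L a ∈ p
      rwa [hL]
  choose! q hq0 hq using key
  let P := Q * ∏ p ∈ hfin.toFinset, q p
  have hP : P ≠ 0 := mul_ne_zero hQ (Finset.prod_ne_zero_iff.2
      fun p hp => hq0 p (by simpa using hp))
  obtain ⟨a, ha⟩ : ∃ a, eval a P ≠ 0 := by
    by_contra! hcon
    exact hP (MvPolynomial.funext fun a => by rw [hcon, map_zero])
  rw [map_mul, map_prod, mul_ne_zero_iff, Finset.prod_ne_zero_iff] at ha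
  exact ⟨a, ha.1, fun p hp hmem => ha.2 p (by simpa using hp) (hq p hp a hmem)⟩

/-- A general linear form cuts down the dimension. -/
theorem exists_ringKrullDim_sup_linForm_le {K : Type*} [Field K] [Infinite K] {n : ℕ}
    (I : Ideal (MvPolynomial (Fin n) K)) {s : ℕ}
    (hI : ringKrullDim (MvPolynomial (Fin n) K ⧸ I) ≤ (s : WithBot ℕ∞))
    {Q : MvPolynomial (Fin n) K} (hQ : Q ≠ 0) :
    ∃ a : Fin n → K, eval a Q ≠ 0 ∧
      ringKrullDim (MvPolynomial (Fin n) K ⧸ (I ⊔ Ideal.span {linForm a})) ≤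
        ((s - 1 : ℕ) : WithBot ℕ∞) := by
  obtain ⟨a, haQ, ha⟩ := exists_linForm_notMem
    (S := {p ∈ I.minimalPrimes | ¬ idealOfVars (Fin n) K ≤ p})
    ((Ideal.finite_minimalPrimes_of_isNoetherianRing _ I).subset fun p hp => hp.1)
    (fun p hp => hp.2) hQ
  refine ⟨a, haQ, ?_⟩
  rw [ringKrullDim_quotient] at hI ⊢
  refine iSup_le fun l => ?_
  have hle : I ⊔ Ideal.span {linForm a} ≤ l.head.1.asIdeal := l.head.2
  obtain ⟨p, hp, hpl⟩ := Ideal.exists_minimalPrimes_le (le_sup_left.trans hle)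
  have hpp : p.IsPrime := hp.1.1
  have hmem : linForm a ∈ l.head.1.asIdeal := (le_sup_right.trans hle) (Ideal.subset_span rfl)
  by_cases hpm : idealOfVars (Fin n) K ≤ p
  · have hmax : l.head.1.asIdeal.IsMaximal := by
      rw [← (idealOfVars_isMaximal K n).eq_of_le l.head.1.2.ne_top (hpm.trans hpl)]
      exact idealOfVars_isMaximal K n
    have h0 : l.length = 0 := by
      by_contra hne
      have hlt : l.head < l.last := l.strictMono (by
        rw [Fin.lt_def]
        simpa using Nat.pos_of_ne_zero hne)
      exact hlt.ne (Subtype.ext (PrimeSpectrum.ext (hmax.eq_of_le l.last.1.2.ne_top hlt.le)))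
    rw [h0]
    exact_mod_cast Nat.zero_le (s - 1)
  · let p₀ : PrimeSpectrum.zeroLocus (I : Set (MvPolynomial (Fin n) K)) := ⟨⟨p, hpp⟩, hp.1.2⟩
    let l' : LTSeries (PrimeSpectrum.zeroLocus (I : Set (MvPolynomial (Fin n) K))) :=
      l.map (fun r => ⟨r.1, le_sup_left.trans (show I ⊔ Ideal.span {linForm a} ≤ _ from r.2)⟩)
        (fun _ _ h => h)
    have hlt : p₀ < l'.head := by
      refine lt_of_le_of_ne hpl fun h => ha p ⟨hp, hpm⟩ ?_
      have h' : p = l.head.1.asIdeal := congrArg (fun r => r.1.asIdeal) h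
      rwa [h']
    have := (Order.LTSeries.length_le_krullDim (l'.cons p₀ hlt)).trans hI
    have h2 : l.length + 1 ≤ s := by
      have h3 : (l'.cons p₀ hlt).length = l.length + 1 := by
        rw [RelSeries.cons_length]
        rfl
      rw [h3] at this
      exact_mod_cast this
    exact_mod_cast (by omega : l.length ≤ s - 1)

theorem exists_homogeneousComponent_mul_eq {R σ : Type*} [CommSemiring R] {f : MvPolynomial σ R}
    {e : ℕ} (hf : f.IsHomogeneous e) (N : ℕ) (g : MvPolynomial σ R) :
    ∃ g' : MvPolynomial σ R, g'.totalDegree ≤ N - e ∧ homogeneousComponent N (g * f) = g' * f := by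
  induction g using MvPolynomial.induction_on' with
  | add p q hp hq =>
    obtain ⟨p', hp, hp'⟩ := hp
    obtain ⟨q', hq, hq'⟩ := hq
    exact ⟨p' + q', (totalDegree_add _ _).trans (max_le hp hq), by
      rw [add_mul, map_add, hp', hq', add_mul]⟩
  | monomial u a =>
    have h : (monomial u a * f).IsHomogeneous (u.degree + e) :=
      (isHomogeneous_monomial a rfl).mul hf
    rw [homogeneousComponent_of_mem h]
    split_ifs with hN
    · refine ⟨monomial u a, ?_, rfl⟩
      rw [hN, Nat.add_sub_cancel]
      exact (isHomogeneous_monomial a rfl).totalDegree_le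
    · exact ⟨0, by simp, by simp⟩

/-- If homogeneous polynomials killed by a surjection `π` and `t` linear forms have only the trivial
common zero, the target of `π` is finite over the polynomial ring generated by these forms. -/
theorem finite_eval₂Hom_linForm {K ι R : Type*} [Field K] [IsAlgClosed K] [CommRing R] [Fintype ι]
    {m t : ℕ} (π : MvPolynomial (Fin m) K →+* R) (hπ : Function.Surjective π)
    (F : ι → MvPolynomial (Fin m) K) (e : ι → ℕ) (he : ∀ i, (F i).IsHomogeneous (e i))
    (hπF : ∀ i, π (F i) = 0)
    (b : Fin t → Fin m → K)
    (hF : ∀ x : Fin m → K, (∀ i, eval x (F i) = 0) → (∀ j, ∑ i, b j i * x i = 0) → x = 0) :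
    (eval₂Hom (π.comp C) fun j => π (linForm (b j))).Finite := by
  classical
  set g : MvPolynomial (Fin t) K →+* R := eval₂Hom (π.comp C) fun j => π (linForm (b j)) with hg
  algebraize [g]
  obtain ⟨N₀, hN₀⟩ := exists_monomial_mem_span_of_forall_zero
    (Sum.elim F fun j => linForm (b j)) (fun x hx => hF x (fun i => hx (Sum.inl i))
      fun j => by simpa [eval_linForm] using hx (Sum.inr j))
  obtain ⟨N, hNpos, hN⟩ : ∃ N : ℕ, 0 < N ∧ ∀ u : Fin m →₀ ℕ, N ≤ u.degree →
      monomial u (1 : K) ∈ Ideal.span (Set.range (Sum.elim F fun j => linForm (b j))) :=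
    ⟨N₀ + 1, by omega, fun u hu => hN₀ u (by omega)⟩
  let W : Submodule (MvPolynomial (Fin t) K) R :=
    Submodule.span _ ((fun u => π (monomial u 1)) '' {u : Fin m →₀ ℕ | u.degree < N})
  have hsmulC : ∀ (c : K) (y : R), (C c : MvPolynomial (Fin t) K) • y = π (C c) * y :=
    fun c y => by
      rw [Algebra.smul_def]
      congr 1
      simp [RingHom.algebraMap_toAlgebra, g]
  have hsmulX : ∀ (j : Fin t) (y : R),
      (X j : MvPolynomial (Fin t) K) • y = π (linForm (b j)) * y := fun c y => by
    rw [Algebra.smul_def]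
    congr 1
    simp [RingHom.algebraMap_toAlgebra, g]
  have hsum : ∀ (n : ℕ), (∀ u : Fin m →₀ ℕ, u.degree ≤ n → π (monomial u 1) ∈ W) →
      ∀ f : MvPolynomial (Fin m) K, f.totalDegree ≤ n → π f ∈ W := by
    intro n hn f hf
    rw [f.as_sum, map_sum]
    refine Submodule.sum_mem _ fun u hu => ?_
    have : monomial u (coeff u f) = C (coeff u f) * monomial u 1 := by simp [C_mul_monomial]
    rw [this, map_mul, ← hsmulC]
    refine Submodule.smul_mem _ _ (hn u ?_)
    rw [Finsupp.degree_eq_sum]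
    refine le_trans ?_ ((le_totalDegree hu).trans hf)
    rw [Finsupp.sum_fintype _ _ fun _ => rfl]
  have hmon : ∀ (n : ℕ) (u : Fin m →₀ ℕ), u.degree ≤ n → π (monomial u 1) ∈ W := by
    intro n
    induction n with
    | zero => exact fun u hu => Submodule.subset_span ⟨u, lt_of_le_of_lt hu hNpos, rfl⟩
    | succ n ih =>
      intro u hu
      by_cases hd : u.degree < N
      · exact Submodule.subset_span ⟨u, hd, rfl⟩
      rcases hu.lt_or_eq with hlt | heq
      · exact ih u (by omega)
      obtain ⟨c, hc⟩ := Ideal.mem_span_range_iff_exists_fun.1 (hN u (by omega))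
      rw [Fintype.sum_sum_type] at hc
      have hcF := fun i => exists_homogeneousComponent_mul_eq (he i) (n + 1) (c (Sum.inl i))
      have hcl := fun j => exists_homogeneousComponent_mul_eq (isHomogeneous_linForm (b j)) (n + 1)
        (c (Sum.inr j))
      choose cF hcF hcF' using hcF
      choose cl hcl hcl' using hcl
      have h := congrArg (fun f => π (homogeneousComponent (n + 1) f)) hc
      simp only [Sum.elim_inl, Sum.elim_inr, map_add, map_sum, hcF', hcl', map_mul, hπF, mul_zero,
        Finset.sum_const_zero, zero_add] at h
      rw [homogeneousComponent_of_mem (isHomogeneous_monomial 1 heq), if_pos rfl] at h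
      rw [← h]
      refine Submodule.sum_mem _ fun j _ => ?_
      rw [mul_comm, ← hsmulX]
      exact Submodule.smul_mem _ _ (hsum n ih _ (hcl j))
  refine ⟨⟨((Finset.range N).biUnion fun n =>
    Finset.finsuppAntidiag (Finset.univ : Finset (Fin m)) n).image fun u => π (monomial u 1), ?_⟩⟩
  rw [eq_top_iff]
  rintro y -
  obtain ⟨f, rfl⟩ := hπ y
  have : π f ∈ W := hsum _ (hmon _) f le_rfl
  have hset : (((Finset.range N).biUnion fun n =>
      Finset.finsuppAntidiag (Finset.univ : Finset (Fin m)) n).image fun u => π (monomial u 1) :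
      Set R) = (fun u => π (monomial u 1)) '' {u : Fin m →₀ ℕ | u.degree < N} := by
    ext y
    simp [Finset.mem_finsuppAntidiag, Finsupp.degree_eq_sum]
  rw [hset]
  exact this

theorem ringKrullDim_le_of_ringHom_isIntegral {R S : Type*} [CommRing R] [CommRing S] {f : R →+* S}
    (hf : f.IsIntegral) : ringKrullDim S ≤ ringKrullDim R := by
  algebraize [f]
  exact Order.krullDim_le_of_strictMono (PrimeSpectrum.comap f) fun p q hpq =>
    Ideal.IsIntegral.comap_lt_comap (R := R) (I := p.asIdeal) (J := q.asIdeal) hpq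

/-- A homogeneous ideal whose zero locus meets the common zero set of `t` linear forms only in the
origin defines a variety of dimension at most `t`. -/
theorem ringKrullDim_quotient_le_of_forall_zero {K ι : Type*} [Field K] [IsAlgClosed K] [Fintype ι]
    {m t : ℕ} (F : ι → MvPolynomial (Fin m) K) (e : ι → ℕ) (he : ∀ i, (F i).IsHomogeneous (e i))
    (b : Fin t → Fin m → K)
    (hF : ∀ x : Fin m → K, (∀ i, eval x (F i) = 0) → (∀ j, ∑ i, b j i * x i = 0) → x = 0) :
    ringKrullDim (MvPolynomial (Fin m) K ⧸ Ideal.span (Set.range F)) ≤ (t : WithBot ℕ∞) := by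
  have hfin := finite_eval₂Hom_linForm (Ideal.Quotient.mk (Ideal.span (Set.range F)))
    Ideal.Quotient.mk_surjective F e he
    (fun i => Ideal.Quotient.eq_zero_iff_mem.2 (Ideal.subset_span ⟨i, rfl⟩)) b hF
  exact (ringKrullDim_le_of_ringHom_isIntegral hfin.to_isIntegral).trans (by simp)

theorem aeval_mul_of_isHomogeneous {R A σ : Type*} [CommSemiring R] [CommSemiring A] [Algebra R A]
    {f : MvPolynomial σ R} {e : ℕ} (hf : f.IsHomogeneous e) (r : A) (x : σ → A) :
    aeval (fun i => r * x i) f = r ^ e * aeval x f := by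
  rw [aeval_def, aeval_def, eval₂_eq, eval₂_eq, Finset.mul_sum]
  refine Finset.sum_congr rfl fun u hu => ?_
  have hu' : ∑ i ∈ u.support, u i = e := by
    rw [← hf (mem_support_iff.1 hu), Finsupp.weight_apply]
    simp [Finsupp.sum]
  simp only [mul_pow, Finset.prod_mul_distrib, Finset.prod_pow_eq_pow_sum, hu']
  ring

theorem eval_mul_of_isHomogeneous {R σ : Type*} [CommSemiring R]
    {f : MvPolynomial σ R} {e : ℕ} (hf : f.IsHomogeneous e) (r : R) (x : σ → R) :
    eval (fun i => r * x i) f = r ^ e * eval x f := by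
  simpa only [aeval_eq_eval, RingHom.coe_coe] using aeval_mul_of_isHomogeneous hf r x

/-- A cone of dimension at most `0` is contained in the origin. -/
theorem eq_zero_of_ringKrullDim_quotient_le_zero {K : Type*} [Field K] {n : ℕ}
    {S : Set (MvPolynomial (Fin n) K)} (hS : ∀ f ∈ S, ∃ e, f.IsHomogeneous e)
    (hdim : ringKrullDim (MvPolynomial (Fin n) K ⧸ Ideal.span S) ≤ ((0 : ℕ) : WithBot ℕ∞))
    {x : Fin n → K} (hx : ∀ f ∈ S, eval x f = 0) : x = 0 := by
  by_contra hx0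
  obtain ⟨i, hi⟩ := Function.ne_iff.1 hx0
  let φ : MvPolynomial (Fin n) K →+* Polynomial K :=
    (aeval fun i => Polynomial.X * Polynomial.C (x i) : _ →ₐ[K] Polynomial K).toRingHom
  have hle : Ideal.span S ≤ RingHom.ker φ := by
    rw [Ideal.span_le]
    intro f hf
    obtain ⟨e, he⟩ := hS f hf
    have h1 : φ f = Polynomial.X ^ e * aeval (fun i => Polynomial.C (x i)) f :=
      aeval_mul_of_isHomogeneous he _ _
    have h2 : aeval (fun i => Polynomial.C (x i)) f = Polynomial.C (eval x f) := by
      have : (aeval fun i => Polynomial.C (x i) : _ →ₐ[K] Polynomial K).toRingHom =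
          Polynomial.C.comp (eval x) := ringHom_ext (fun r => by simp) fun i => by simp
      exact RingHom.congr_fun this f
    rw [SetLike.mem_coe, RingHom.mem_ker, h1, h2, hx f hf, map_zero, mul_zero]
  have hcomp : ((Polynomial.evalRingHom 1).comp φ) = eval x :=
    ringHom_ext (fun r => by simp [φ]) fun i => by simp [φ]
  have hker : RingHom.ker φ ≤ RingHom.ker (eval x) := fun f hf => by
    rw [RingHom.mem_ker, ← hcomp, RingHom.comp_apply, (RingHom.mem_ker).1 hf, map_zero]
  have hp : (RingHom.ker φ).IsPrime := RingHom.ker_isPrime φ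
  have hp' : (RingHom.ker (eval x)).IsPrime := RingHom.ker_isPrime _
  let p : PrimeSpectrum.zeroLocus (Ideal.span S : Set (MvPolynomial (Fin n) K)) := ⟨⟨_, hp⟩, hle⟩
  let p' : PrimeSpectrum.zeroLocus (Ideal.span S : Set (MvPolynomial (Fin n) K)) :=
    ⟨⟨_, hp'⟩, hle.trans hker⟩
  have hlt : p < p' := by
    refine lt_of_le_of_ne hker fun h => hi ?_
    have h' : RingHom.ker φ = RingHom.ker (eval x) := congrArg (fun r => r.1.asIdeal) h
    have hmem : X i - C (x i) ∈ RingHom.ker (eval x) := by simp [RingHom.mem_ker]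
    rw [← h', RingHom.mem_ker] at hmem
    have := congrArg (Polynomial.coeff · 1) hmem
    simpa [φ] using this
  rw [ringKrullDim_quotient] at hdim
  have := (Order.LTSeries.length_le_krullDim ((RelSeries.singleton _ p').cons p hlt)).trans hdim
  norm_cast at this

theorem exists_ringKrullDim_sup_span_linForm_le {K : Type*} [Field K] [Infinite K] {n : ℕ} (s : ℕ)
    (I : Ideal (MvPolynomial (Fin n) K))
    (hI : ringKrullDim (MvPolynomial (Fin n) K ⧸ I) ≤ (s : WithBot ℕ∞)) :
    ∃ b : Fin s → Fin n → K,
      ringKrullDim (MvPolynomial (Fin n) K ⧸ (I ⊔ Ideal.span (Set.range fun j => linForm (b j)))) ≤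
        ((0 : ℕ) : WithBot ℕ∞) := by
  induction s generalizing I with
  | zero => exact ⟨0, by rwa [Set.range_eq_empty, Ideal.span_empty, sup_bot_eq]⟩
  | succ s ih =>
    obtain ⟨a, -, ha⟩ := exists_ringKrullDim_sup_linForm_le I hI one_ne_zero
    obtain ⟨b, hb⟩ := ih _ ha
    refine ⟨Fin.cons a b, ?_⟩
    have : Set.range (fun j => linForm ((Fin.cons a b : Fin (s + 1) → Fin n → K) j)) =
        {linForm a} ∪ Set.range fun j => linForm (b j) := by
      ext f
      simp [Fin.exists_fin_succ, eq_comm]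
    rwa [this, Ideal.span_union, ← sup_assoc]

/-- Substitution of a linear form in the other variables for the last variable. -/
noncomputable def substLast {R : Type*} [CommRing R] {m : ℕ} (a : Fin m → R) :
    MvPolynomial (Fin (m + 1)) R →ₐ[R] MvPolynomial (Fin m) R :=
  aeval (Fin.snoc (α := fun _ => MvPolynomial (Fin m) R) X (linForm a))

theorem eval_substLast {R : Type*} [CommRing R] {m : ℕ} (a y : Fin m → R)
    (f : MvPolynomial (Fin (m + 1)) R) :
    eval y (substLast a f) = eval (Fin.snoc (α := fun _ => R) y (∑ j, a j * y j)) f := by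
  have : (eval y).comp (substLast a).toRingHom =
      eval (Fin.snoc (α := fun _ => R) y (∑ j, a j * y j)) := by
    refine ringHom_ext (fun r => by simp [substLast]) fun i => ?_
    refine Fin.lastCases ?_ (fun i => ?_) i <;> simp [substLast, eval_linForm]
  exact RingHom.congr_fun this f

theorem map_substLast {R S : Type*} [CommRing R] [CommRing S] {m : ℕ} (φ : R →+* S) (a : Fin m → R)
    (f : MvPolynomial (Fin (m + 1)) R) :
    map φ (substLast a f) = substLast (fun i => φ (a i)) (map φ f) := by
  have : (map φ).comp (substLast a).toRingHom =
      (substLast fun i => φ (a i)).toRingHom.comp (map φ) := by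
    refine ringHom_ext (fun r => by simp [substLast]) fun i => ?_
    refine Fin.lastCases ?_ (fun i => ?_) i <;> simp [substLast, linForm]
  exact RingHom.congr_fun this f

theorem isHomogeneous_substLast {R : Type*} [CommRing R] {m : ℕ} (a : Fin m → R)
    {f : MvPolynomial (Fin (m + 1)) R} {k : ℕ} (hf : f.IsHomogeneous k) :
    (substLast a f).IsHomogeneous k := by
  have := hf.aeval (Fin.snoc (α := fun _ => MvPolynomial (Fin m) R) X (linForm a)) (n := 1)
    fun i => by
      refine Fin.lastCases ?_ (fun i => ?_) i
      · simpa using isHomogeneous_linForm a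
      · simpa using isHomogeneous_X R i
  rwa [one_mul] at this

theorem pderiv_substLast {R : Type*} [CommRing R] {m : ℕ} (a : Fin m → R) (i : Fin m)
    (f : MvPolynomial (Fin (m + 1)) R) :
    pderiv i (substLast a f) = substLast a (pderiv i.castSucc f) +
      C (a i) * substLast a (pderiv (Fin.last m) f) := by
  induction f using MvPolynomial.induction_on with
  | C r => simp [substLast]
  | add p q hp hq =>
    simp only [map_add, hp, hq]
    ring
  | mul_X p j hp =>
    have hl : pderiv i (linForm a) = C (a i) := by
      simp [linForm, pderiv_X, Pi.single_apply]
    simp only [map_mul, Derivation.leibniz, smul_eq_mul, map_add, hp]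
    refine Fin.lastCases ?_ (fun j => ?_) j
    · have : pderiv i (substLast a (X (Fin.last m))) = C (a i) := by simp [substLast, hl]
      rw [this, pderiv_X_self, pderiv_X_of_ne (Fin.castSucc_lt_last i).ne']
      simp
      ring
    · have : pderiv i (substLast a (X j.castSucc)) =
          substLast a (pderiv i.castSucc (X j.castSucc)) := by
        simp [substLast, pderiv_X, Pi.single_apply]
      rw [this, pderiv_X_of_ne (i := Fin.last m) (Fin.castSucc_lt_last j).ne]
      simp
      ring

/-- The common zero set of the partial derivatives of `F` and of the linear forms with
coefficients `b j` consists at most of the origin. -/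
def SingularOnlyAtZero {R : Type*} [CommRing R] {m t : ℕ} (F : MvPolynomial (Fin m) R)
    (b : Fin t → Fin m → R) : Prop :=
  ∀ y : Fin m → R, (∀ i, eval y (pderiv i F) = 0) → (∀ j, ∑ i, b j i * y i = 0) → y = 0

/-- A Bertini theorem for the singular locus of a general hyperplane section through the origin. -/
theorem exists_singularOnlyAtZero_substLast {K : Type*} [Field K] [IsAlgClosed K] {m k s : ℕ}
    {H : MvPolynomial (Fin (m + 1)) K} (hH : H.IsHomogeneous k) (hk : 2 ≤ k) (hkK : (k : K) ≠ 0)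
    (hH0 : H ≠ 0)
    (hdim : ringKrullDim (MvPolynomial (Fin (m + 1)) K ⧸
      Ideal.span (insert H (Set.range fun i => pderiv i H))) ≤ (s : WithBot ℕ∞)) :
    ∃ (a : Fin m → K) (b : Fin (s - 1) → Fin m → K), SingularOnlyAtZero (substLast a H) b := by
  obtain ⟨P, hP, hHP⟩ := exists_dvd_aeval (fun i => pderiv i H) hH0
  obtain ⟨α, hα, hdim⟩ := exists_ringKrullDim_sup_linForm_le _ hdim
    (mul_ne_zero hP (X_ne_zero (Fin.last m)))
  obtain ⟨l, hdim⟩ := exists_ringKrullDim_sup_span_linForm_le _ _ hdim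
  rw [map_mul, eval_X, mul_ne_zero_iff] at hα
  obtain ⟨hαP, hα⟩ := hα
  refine ⟨fun j => -α j.castSucc / α (Fin.last m),
    fun j i => l j i.castSucc + l j (Fin.last m) * (-α i.castSucc / α (Fin.last m)), ?_⟩
  intro y hy hly
  set a : Fin m → K := fun j => -α j.castSucc / α (Fin.last m) with ha
  set x : Fin (m + 1) → K := Fin.snoc (α := fun _ => K) y (∑ j, a j * y j) with hx
  have hxlast : x (Fin.last m) = ∑ j, a j * y j := by simp [hx]
  have hxcast : ∀ i : Fin m, x i.castSucc = y i := fun i => by simp [hx]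
  have hαx : ∑ i, α i * x i = 0 := by
    rw [Fin.sum_univ_castSucc, hxlast, Finset.mul_sum, ← Finset.sum_add_distrib]
    refine Finset.sum_eq_zero fun i _ => ?_
    rw [hxcast, ha]
    field_simp
    ring
  have hlx : ∀ j, ∑ i, l j i * x i = 0 := fun j => by
    rw [Fin.sum_univ_castSucc, hxlast, Finset.mul_sum, ← Finset.sum_add_distrib, ← hly j]
    refine Finset.sum_congr rfl fun i _ => ?_
    rw [hxcast]
    ring
  set c := eval x (pderiv (Fin.last m) H) / α (Fin.last m) with hc
  have hgrad : ∀ i, eval x (pderiv i H) = c * α i := by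
    intro i
    refine Fin.lastCases ?_ (fun i => ?_) i
    · rw [hc]
      field_simp
    · have := hy i
      rw [pderiv_substLast, map_add, map_mul, eval_C, eval_substLast, eval_substLast, ← hx] at this
      have hai : a i = -α i.castSucc / α (Fin.last m) := rfl
      rw [eq_neg_of_add_eq_zero_left this, hc, hai]
      field_simp
  have hHx : eval x H = 0 := by
    have h := congrArg (eval x) hH.sum_X_mul_pderiv
    simp only [map_sum, map_mul, eval_X, hgrad, nsmul_eq_mul, map_natCast] at h
    have h0 : ∑ i, x i * (c * α i) = c * ∑ i, α i * x i := by
      rw [Finset.mul_sum]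
      exact Finset.sum_congr rfl fun i _ => by ring
    rw [h0, hαx, mul_zero, eq_comm, mul_eq_zero] at h
    exact h.resolve_left hkK
  have hc0 : c = 0 := by
    by_contra hc0
    obtain ⟨μ, hμ⟩ := IsAlgClosed.exists_pow_nat_eq c⁻¹ (show 0 < k - 1 by omega)
    have h1 : ∀ i, eval (fun i => μ * x i) (pderiv i H) = α i := fun i => by
      rw [eval_mul_of_isHomogeneous hH.pderiv, hgrad, hμ, inv_mul_cancel_left₀ hc0]
    obtain ⟨Q, hQ⟩ := hHP
    have h2 := congrArg (eval fun i => μ * x i) hQ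
    rw [map_mul, eval_mul_of_isHomogeneous hH, hHx, mul_zero, zero_mul] at h2
    refine hαP ?_
    rw [← h2]
    have h3 : (eval fun i => μ * x i).comp (aeval fun i => pderiv i H : _ →ₐ[K] _).toRingHom =
        eval α := ringHom_ext (fun r => by simp) fun i => by simp [h1]
    exact (RingHom.congr_fun h3 P).symm
  rw [← Ideal.span_union, ← Ideal.span_union] at hdim
  have hx0 : x = 0 := by
    refine eq_zero_of_ringKrullDim_quotient_le_zero ?_ hdim ?_
    · rintro f (((rfl | ⟨i, rfl⟩) | rfl) | ⟨i, rfl⟩)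
      exacts [⟨k, hH⟩, ⟨k - 1, hH.pderiv⟩,
        ⟨1, isHomogeneous_linForm _⟩, ⟨1, isHomogeneous_linForm _⟩]
    · rintro f (((rfl | ⟨i, rfl⟩) | rfl) | ⟨i, rfl⟩)
      · exact hHx
      · simp only [hgrad, hc0, zero_mul]
      · rw [eval_linForm, hαx]
      · simp only [eval_linForm, hlx]
  funext i
  rw [← hxcast, hx0, Pi.zero_apply, Pi.zero_apply]

theorem SingularOnlyAtZero.ringKrullDim_le {K : Type*} [Field K] [IsAlgClosed K] {m t k : ℕ}
    {F : MvPolynomial (Fin m) K} (hF : F.IsHomogeneous k) {b : Fin t → Fin m → K}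
    (h : SingularOnlyAtZero F b) :
    ringKrullDim (MvPolynomial (Fin m) K ⧸
      Ideal.span (insert F (Set.range fun i => pderiv i F))) ≤ (t : WithBot ℕ∞) := by
  have hrange : insert F (Set.range fun i => pderiv i F) =
      Set.range fun o : Option (Fin m) => o.elim F fun i => pderiv i F := by
    ext f
    simp [Option.exists, eq_comm]
  rw [hrange]
  refine ringKrullDim_quotient_le_of_forall_zero _ (fun o => o.elim k fun _ => k - 1) ?_ b
    fun x hx => h x fun i => hx (some i)
  rintro (_ | i)
  exacts [hF, hF.pderiv]

theorem SingularOnlyAtZero.ne_zero {K : Type*} [Field K] {m t : ℕ} (htm : t < m)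
    {F : MvPolynomial (Fin m) K} {b : Fin t → Fin m → K} (h : SingularOnlyAtZero F b) : F ≠ 0 := by
  rintro rfl
  obtain ⟨y, hy, hy0⟩ := Submodule.exists_mem_ne_zero_of_ne_bot
    (LinearMap.ker_ne_bot_of_finrank_lt (f := (Matrix.of b).mulVecLin) (by simpa using htm))
  refine hy0 (h y (by simp) fun j => ?_)
  exact congrFun hy j

theorem SingularOnlyAtZero.map_ringEquiv {K L : Type*} [CommRing K] [CommRing L] (e : K ≃+* L)
    {m t : ℕ} {F : MvPolynomial (Fin m) K} {b : Fin t → Fin m → K} (h : SingularOnlyAtZero F b) :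
    SingularOnlyAtZero (map (e : K →+* L) F) fun j i => e (b j i) := by
  intro y hy hb
  have hye : y = fun i => e (e.symm (y i)) := by simp
  have h0 := h (fun i => e.symm (y i)) (fun i => e.injective ?_) fun j => e.injective ?_
  · funext i
    simpa using congrFun h0 i
  · have := hy i
    rw [pderiv_map, eval_map, hye] at this
    rw [map_zero, ← this]
    exact eval₂_comp_left (e : K →+* L) (RingHom.id K) _ _
  · rw [map_zero, ← hb j]
    simp

theorem singIdeal_eq {m : ℕ} (ℓ : ℕ) (K : Type) [Field K] [Algebra (ZMod ℓ) K]
    (F : MvPolynomial (Fin m) (ZMod ℓ)) :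
    singIdeal ℓ K F = Ideal.span (insert (map (algebraMap (ZMod ℓ) K) F)
      (Set.range fun i => pderiv i (map (algebraMap (ZMod ℓ) K) F))) := by
  simp only [singIdeal, pderiv_map]

theorem le_of_singLocusDimEq {ℓ m s : ℕ} [Fact ℓ.Prime] {F : MvPolynomial (Fin (m + 1)) (ZMod ℓ)}
    (hF : F ≠ 0) (h : SingLocusDimEq ℓ F s) : s ≤ m := by
  have hs := h (AlgebraicClosure (ZMod ℓ)) inferInstance inferInstance
  set K := AlgebraicClosure (ZMod ℓ)
  set f := map (algebraMap (ZMod ℓ) K) F with hf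
  have hf0 : f ≠ 0 := fun h0 => hF (map_injective _ (algebraMap (ZMod ℓ) K).injective
    (by rw [← hf, h0, map_zero]))
  have h1 := ringKrullDim_quotient_succ_le_of_nonZeroDivisor (mem_nonZeroDivisors_of_ne_zero hf0)
  have h2 : ringKrullDim (MvPolynomial (Fin (m + 1)) K ⧸ singIdeal ℓ K F) ≤
      ringKrullDim (MvPolynomial (Fin (m + 1)) K ⧸ Ideal.span {f}) := by
    refine ringKrullDim_le_of_surjective (Ideal.Quotient.factor ?_)
      (Ideal.Quotient.factor_surjective _)
    exact Ideal.span_mono (Set.singleton_subset_iff.2 (Set.mem_insert _ _))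
  rw [hs] at h2
  have h3 := (add_le_add_left h2 1).trans h1
  rw [MvPolynomial.ringKrullDim_of_isNoetherianRing] at h3
  change ((s : WithBot ℕ∞) + 1 ≤ _) at h3
  simp at h3
  norm_cast at h3
  omega

theorem exists_singularOnlyAtZero_of_algebraicClosure {ℓ m t : ℕ} [Fact ℓ.Prime]
    {F : MvPolynomial (Fin m) (ZMod ℓ)} {b : Fin t → Fin m → AlgebraicClosure (ZMod ℓ)}
    (h : SingularOnlyAtZero (map (algebraMap (ZMod ℓ) (AlgebraicClosure (ZMod ℓ))) F) b)
    (K : Type) [Field K] [Algebra (ZMod ℓ) K] (hK : IsAlgClosed K)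
    (hK' : Algebra.IsAlgebraic (ZMod ℓ) K) :
    ∃ b' : Fin t → Fin m → K, SingularOnlyAtZero (map (algebraMap (ZMod ℓ) K) F) b' := by
  have : IsAlgClosure (ZMod ℓ) K := ⟨hK, hK'⟩
  let e := IsAlgClosure.equiv (ZMod ℓ) (AlgebraicClosure (ZMod ℓ)) K
  have he : (e.toRingEquiv : AlgebraicClosure (ZMod ℓ) →+* K).comp
      (algebraMap (ZMod ℓ) (AlgebraicClosure (ZMod ℓ))) = algebraMap (ZMod ℓ) K :=
    RingHom.ext fun r => e.commutes r
  have h' := h.map_ringEquiv e.toRingEquiv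
  rw [map_map, he] at h'
  exact ⟨_, h'⟩

theorem singLocusDimLe_of_singularOnlyAtZero {ℓ m t k : ℕ} [Fact ℓ.Prime]
    {F : MvPolynomial (Fin m) (ZMod ℓ)} (hF : F.IsHomogeneous k)
    {b : Fin t → Fin m → AlgebraicClosure (ZMod ℓ)}
    (h : SingularOnlyAtZero (map (algebraMap (ZMod ℓ) (AlgebraicClosure (ZMod ℓ))) F) b) :
    SingLocusDimLe ℓ F t := by
  intro K _ _ hK hK'
  obtain ⟨b', hb'⟩ := exists_singularOnlyAtZero_of_algebraicClosure h K hK hK'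
  rw [singIdeal_eq]
  exact hb'.ringKrullDim_le (hF.map _)

theorem nonsingularOverFp_of_singularOnlyAtZero {ℓ m : ℕ} [Fact ℓ.Prime]
    {F : MvPolynomial (Fin m) (ZMod ℓ)} {b : Fin 0 → Fin m → AlgebraicClosure (ZMod ℓ)}
    (h : SingularOnlyAtZero (map (algebraMap (ZMod ℓ) (AlgebraicClosure (ZMod ℓ))) F) b) :
    NonsingularOverFp ℓ F := by
  intro K _ _ hK hK' x hx
  obtain ⟨b', hb'⟩ := exists_singularOnlyAtZero_of_algebraicClosure h K hK hK'
  exact hb' x (fun i => by rw [pderiv_map, eval_map, ← aeval_def, hx i]) fun j => j.elim0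

theorem NonsingularOverFp.singularOnlyAtZero {ℓ m : ℕ} [Fact ℓ.Prime]
    {F : MvPolynomial (Fin m) (ZMod ℓ)} (h : NonsingularOverFp ℓ F) :
    SingularOnlyAtZero (map (algebraMap (ZMod ℓ) (AlgebraicClosure (ZMod ℓ))) F)
      (0 : Fin 0 → Fin m → AlgebraicClosure (ZMod ℓ)) := fun x hx _ =>
  h _ inferInstance inferInstance x fun i => by
    rw [aeval_def, ← eval_map, ← pderiv_map, hx i]

/-- Uniformly in the field, the hyperplane sections of a form of degree `k` with singular locus
cut down to the origin by given linear forms contain the complement of a hypersurface of bounded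
degree, unless there are none. -/
theorem exists_totalDegree_le_of_singularOnlyAtZero (m k t : ℕ) :
    ∃ D : ℕ, ∀ (K : Type) [Field K] [IsAlgClosed K] (H : MvPolynomial (Fin (m + 1)) K),
      H.IsHomogeneous k → ∀ (a₀ : Fin m → K) (b : Fin t → Fin m → K),
      SingularOnlyAtZero (substLast a₀ H) b →
      ∃ P : MvPolynomial (Fin m) K, P ≠ 0 ∧ P.totalDegree ≤ D ∧ ∀ a : Fin m → K, eval a P ≠ 0 →
        SingularOnlyAtZero (substLast a H) b := by
  classical
  let S := Finset.finsuppAntidiag (Finset.univ : Finset (Fin (m + 1))) k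
  have hS : ∀ u, u ∈ S ↔ u.degree = k := fun u => by
    simp [S, Finset.mem_finsuppAntidiag, Finsupp.degree_eq_sum]
  let A := MvPolynomial ((S ⊕ (Fin t × Fin m)) ⊕ Fin m) ℤ
  let U : MvPolynomial (Fin (m + 1)) A := ∑ u : S, monomial u.1 (X (Sum.inl (Sum.inl u)))
  have hU : U.IsHomogeneous k :=
    IsHomogeneous.sum _ _ _ fun u _ => isHomogeneous_monomial _ ((hS u.1).1 u.2)
  let V : MvPolynomial (Fin m) A := substLast (fun j => X (Sum.inr j)) U
  let F : Fin m ⊕ Fin t → MvPolynomial (Fin m) A :=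
    Sum.elim (fun i => pderiv i V) fun j => linForm fun i => X (Sum.inl (Sum.inr (j, i)))
  obtain ⟨D, hD⟩ := exists_totalDegree_le_of_forall_zero F
    (Sum.elim (fun _ => k - 1) fun _ => 1) (by
      rintro (i | j)
      exacts [(isHomogeneous_substLast _ hU).pderiv, isHomogeneous_linForm _])
  refine ⟨D, fun K _ _ H hH a₀ b h₀ => ?_⟩
  let c : S ⊕ (Fin t × Fin m) → K := Sum.elim (fun u => coeff u.1 H) fun q => b q.1 q.2
  have hmap : ∀ a : Fin m → K, map (eval₂Hom (Int.castRingHom K) (Sum.elim c a)) U = H := by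
    intro a
    rw [map_sum]
    simp only [map_monomial, coe_eval₂Hom, eval₂_X, Sum.elim_inl, c]
    conv_rhs => rw [H.as_sum]
    rw [Finset.sum_coe_sort S fun u => monomial u (coeff u H)]
    symm
    refine Finset.sum_subset (fun u hu => (hS u).2 ?_) fun u _ hu => by
      rw [notMem_support_iff.1 hu, monomial_zero]
    by_contra hne
    exact mem_support_iff.1 hu (hH.coeff_eq_zero hne)
  have key : ∀ a : Fin m → K, SingularOnlyAtZero (substLast a H) b ↔ ∀ x : Fin m → K,
      (∀ i, eval₂ (eval₂Hom (Int.castRingHom K) (Sum.elim c a)) x (F i) = 0) → x = 0 := by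
    intro a
    have h1 : ∀ x i, eval₂ (eval₂Hom (Int.castRingHom K) (Sum.elim c a)) x (F (Sum.inl i)) =
        eval x (pderiv i (substLast a H)) := fun x i => by
      rw [← eval_map]
      simp only [F, Sum.elim_inl, ← pderiv_map, V, map_substLast, hmap]
      simp
    have h2 : ∀ x j, eval₂ (eval₂Hom (Int.castRingHom K) (Sum.elim c a)) x (F (Sum.inr j)) =
        ∑ i, b j i * x i := fun x j => by
      simp [F, linForm, eval₂_sum, c]
    simp only [Sum.forall, h1, h2, and_imp, SingularOnlyAtZero]
  obtain ⟨P, hP, hPD, hPa⟩ := hD K c a₀ ((key a₀).1 h₀)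
  exact ⟨P, hP, hPD, fun a ha => (key a).2 (hPa a ha)⟩

theorem isHomogeneous_leadForm {n : ℕ} {R : Type} [CommRing R] (f : MvPolynomial (Fin n) R) :
    (LeadForm f).IsHomogeneous f.totalDegree :=
  homogeneousComponent_isHomogeneous _ _

theorem leadForm_ne_zero {n : ℕ} {R : Type} [CommRing R] {f : MvPolynomial (Fin n) R}
    (hf : f ≠ 0) : LeadForm f ≠ 0 := by
  obtain ⟨u, hu, hdeg⟩ := Finset.exists_mem_eq_sup f.support (support_nonempty.2 hf)
    (fun u => u.sum fun _ e => e)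
  intro h
  have := congrArg (coeff u) h
  rw [LeadForm, coeff_homogeneousComponent, if_pos, coeff_zero] at this
  · exact mem_support_iff.1 hu this
  · rw [totalDegree, hdeg, Finsupp.degree_eq_sum, Finsupp.sum_fintype _ _ fun _ => rfl]

theorem homogeneousComponent_redMod {n : ℕ} (ℓ k : ℕ) (f : MvPolynomial (Fin n) ℤ) :
    homogeneousComponent k (redMod ℓ f) = redMod ℓ (homogeneousComponent k f) := by
  ext u
  simp only [redMod, coeff_homogeneousComponent, coeff_map]
  split_ifs <;> simp

theorem NonsingularOverFp.ne_zero {ℓ m : ℕ} [Fact ℓ.Prime]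
    {F : MvPolynomial (Fin (m + 1)) (ZMod ℓ)} (h : NonsingularOverFp ℓ F) : F ≠ 0 := by
  rintro rfl
  exact one_ne_zero (congrFun (h (AlgebraicClosure (ZMod ℓ))
    inferInstance inferInstance 1 (by simp)) 0)

/-- For nonsingular leading form of `g`, subtracting a multiple of `g` lowers the degree of `h` for
at most one multiple. -/
theorem eq_of_totalDegree_sub_lt {n ℓ d : ℕ} [Fact ℓ.Prime] {h g : MvPolynomial (Fin n) ℤ}
    (hg : g.totalDegree = d) (hG : redMod ℓ (LeadForm g) ≠ 0) {γ γ' : ZMod ℓ}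
    (hγ : (redMod ℓ h - C γ * redMod ℓ g).totalDegree < d)
    (hγ' : (redMod ℓ h - C γ' * redMod ℓ g).totalDegree < d) : γ = γ' := by
  have h1 := homogeneousComponent_eq_zero _ _ hγ
  have h2 := homogeneousComponent_eq_zero _ _ hγ'
  rw [map_sub, homogeneousComponent_C_mul, homogeneousComponent_redMod _ _ g, ← hg] at h1 h2
  rw [sub_eq_zero] at h1 h2
  exact C_injective _ _ (mul_right_cancel₀ hG (h1.symm.trans h2))

/-- The unimodular matrix for the substitution of a linear form for the last variable. -/
def lastRowMatrix {m : ℕ} (a : Fin m → ℤ) : Matrix (Fin (m + 1)) (Fin (m + 1)) ℤ :=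
  Matrix.of fun i j => if i = Fin.last m then Fin.snoc (α := fun _ => ℤ) a 1 j else
    if i = j then 1 else 0

theorem det_lastRowMatrix {m : ℕ} (a : Fin m → ℤ) : (lastRowMatrix a).det = 1 := by
  rw [Matrix.det_of_isLowerTriangular]
  · refine Finset.prod_eq_one fun i _ => ?_
    by_cases hi : i = Fin.last m
    · subst hi
      simp [lastRowMatrix]
    · simp [lastRowMatrix, hi]
  · intro i j hij
    have hij' : i < j := hij
    simp [lastRowMatrix, (hij'.trans_le (Fin.le_last j)).ne, hij'.ne]

theorem abs_lastRowMatrix_le {m : ℕ} {a : Fin m → ℤ} {N : ℤ} (hN : 1 ≤ N) (ha : ∀ i, |a i| ≤ N)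
    (i j : Fin (m + 1)) : |lastRowMatrix a i j| ≤ N := by
  rw [lastRowMatrix, Matrix.of_apply]
  split_ifs
  · refine Fin.lastCases ?_ (fun j => ?_) j
    · simpa using hN
    · simpa using ha j
  · simpa using hN
  · simpa using zero_le_one.trans hN

theorem substZero_lastRowMatrix {m : ℕ} {R : Type} [CommRing R] (a : Fin m → ℤ)
    (f : MvPolynomial (Fin (m + 1)) R) :
    SubstZero (lastRowMatrix a) f = substLast (fun i => (a i : R)) f := by
  unfold SubstZero substLast
  congr 2
  funext i
  rw [Fin.sum_univ_castSucc]
  refine Fin.lastCases ?_ (fun i => ?_) i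
  · simp [lastRowMatrix, linForm]
  · simp [lastRowMatrix, (Fin.castSucc_lt_last i).ne]

theorem two_mul_card_filter_eval_eq_zero_lt {K : Type*} [Field K] [DecidableEq K] {m N : ℕ}
    (hN : Set.InjOn (Nat.cast : ℕ → K) (Finset.range N)) {P : MvPolynomial (Fin m) K} (hP : P ≠ 0)
    (hPN : 2 * P.totalDegree < N) :
    2 * ((Fintype.piFinset fun _ : Fin m => Finset.range N).filter
      fun a => eval (fun i => (a i : K)) P = 0).card < N ^ m := by
  have hS : ((Finset.range N).image (Nat.cast : ℕ → K)).card = N := by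
    rw [Finset.card_image_of_injOn hN, Finset.card_range]
  have hSZ := schwartz_zippel_totalDegree hP ((Finset.range N).image (Nat.cast : ℕ → K))
  rw [hS] at hSZ
  have hle : ((Fintype.piFinset fun _ : Fin m => Finset.range N).filter
      fun a => eval (fun i => (a i : K)) P = 0).card ≤
      ((Fintype.piFinset fun _ : Fin m => (Finset.range N).image (Nat.cast : ℕ → K)).filter
        fun f => eval f P = 0).card := by
    refine Finset.card_le_card_of_injOn (fun a i => (a i : K)) ?_ ?_
    · intro a ha
      simp only [Finset.coe_filter, Fintype.mem_piFinset] at ha ⊢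
      exact ⟨fun i => Finset.mem_image_of_mem _ (ha.1 i), ha.2⟩
    · intro a ha a' ha' h
      simp only [Finset.coe_filter, Fintype.mem_piFinset] at ha ha'
      exact funext fun i => hN (ha.1 i) (ha'.1 i) (congrFun h i)
  have hN0 : (0 : ℚ≥0) < N := by exact_mod_cast (by omega : 0 < N)
  rw [div_le_div_iff₀ (by positivity) hN0] at hSZ
  norm_cast at hSZ
  have hNm : 0 < N ^ m := pow_pos (by omega) _
  refine lt_of_le_of_lt (Nat.mul_le_mul_left 2 hle) (lt_of_mul_lt_mul_right ?_ (Nat.zero_le N))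
  calc _ = 2 * (_ * N) := mul_assoc _ _ _
    _ ≤ 2 * (P.totalDegree * N ^ m) := Nat.mul_le_mul_left 2 hSZ
    _ = (2 * P.totalDegree) * N ^ m := (mul_assoc _ _ _).symm
    _ < N * N ^ m := Nat.mul_lt_mul_of_pos_right hPN hNm
    _ = N ^ m * N := mul_comm _ _

/-- Two nonzero polynomials over possibly different fields are simultaneously nonzero at some
vector of small natural numbers. -/
theorem exists_eval_ne_zero_and_eval_ne_zero {K L : Type*} [Field K] [Field L] {m N : ℕ}
    (hK : Set.InjOn (Nat.cast : ℕ → K) (Finset.range N))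
    (hL : Set.InjOn (Nat.cast : ℕ → L) (Finset.range N))
    {P : MvPolynomial (Fin m) K} (hP : P ≠ 0) (hPN : 2 * P.totalDegree < N)
    {Q : MvPolynomial (Fin m) L} (hQ : Q ≠ 0) (hQN : 2 * Q.totalDegree < N) :
    ∃ a : Fin m → ℕ, (∀ i, a i < N) ∧ eval (fun i => (a i : K)) P ≠ 0 ∧
      eval (fun i => (a i : L)) Q ≠ 0 := by
  classical
  by_contra! hcon
  have h1 := two_mul_card_filter_eval_eq_zero_lt hK hP hPN
  have h2 := two_mul_card_filter_eval_eq_zero_lt hL hQ hQN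
  have h3 : (Fintype.piFinset fun _ : Fin m => Finset.range N) ⊆
      (Fintype.piFinset fun _ : Fin m => Finset.range N).filter
        (fun a => eval (fun i => (a i : K)) P = 0) ∪
      (Fintype.piFinset fun _ : Fin m => Finset.range N).filter
        (fun a => eval (fun i => (a i : L)) Q = 0) := by
    intro a ha
    rw [Finset.mem_union, Finset.mem_filter, Finset.mem_filter, ← and_or_left]
    refine ⟨ha, or_iff_not_imp_left.2 (hcon a fun i => ?_)⟩
    simpa using Fintype.mem_piFinset.1 ha i
  have h4 := (Finset.card_le_card h3).trans (Finset.card_union_le _ _)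
  rw [Fintype.card_piFinset_const, Finset.card_range] at h4
  omega

theorem exists_totalDegree_le_of_singLocusDimLe (m d : ℕ) :
    ∃ D : ℕ, ∀ (ℓ k s : ℕ) [Fact ℓ.Prime], 2 ≤ k → k ≤ d → d < ℓ → s ≤ m →
      ∀ F : MvPolynomial (Fin (m + 1)) (ZMod ℓ), F.IsHomogeneous k → F ≠ 0 →
      SingLocusDimLe ℓ F s →
      ∃ P : MvPolynomial (Fin m) (AlgebraicClosure (ZMod ℓ)), P ≠ 0 ∧ P.totalDegree ≤ D ∧
        ∃ b : Fin (s - 1) → Fin m → AlgebraicClosure (ZMod ℓ), ∀ a : Fin m → ZMod ℓ,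
          eval (fun i => algebraMap (ZMod ℓ) (AlgebraicClosure (ZMod ℓ)) (a i)) P ≠ 0 →
          SingularOnlyAtZero (map (algebraMap (ZMod ℓ) (AlgebraicClosure (ZMod ℓ)))
            (substLast a F)) b := by
  choose D hD using exists_totalDegree_le_of_singularOnlyAtZero m
  refine ⟨∑ k ∈ Finset.range (d + 1), ∑ t ∈ Finset.range (m + 1), D k t, ?_⟩
  intro ℓ k s _ hk hkd hdℓ hsm F hF hF0 hs
  have hsK := hs (AlgebraicClosure (ZMod ℓ)) inferInstance inferInstance
  have hF0' := (map_injective _ (algebraMap (ZMod ℓ) (AlgebraicClosure (ZMod ℓ))).injective).ne hF0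
  rw [map_zero] at hF0'
  rw [singIdeal_eq] at hsK
  have hkK : (k : AlgebraicClosure (ZMod ℓ)) ≠ 0 := by
    have : CharP (AlgebraicClosure (ZMod ℓ)) ℓ := charP_of_injective_algebraMap
      (algebraMap (ZMod ℓ) (AlgebraicClosure (ZMod ℓ))).injective ℓ
    rw [Ne, CharP.cast_eq_zero_iff _ ℓ]
    exact Nat.not_dvd_of_pos_of_lt (by omega) (by omega)
  obtain ⟨a₀, b, h₀⟩ := exists_singularOnlyAtZero_substLast (hF.map _) hk hkK hF0' hsK
  obtain ⟨P, hP, hPD, hPa⟩ := hD k (s - 1) _ _ (hF.map _) a₀ b h₀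
  refine ⟨P, hP, hPD.trans ?_, b, fun a ha => ?_⟩
  · refine le_trans ?_ (Finset.single_le_sum (f := fun k => ∑ t ∈ Finset.range (m + 1), D k t)
      (fun _ _ => Nat.zero_le _) (Finset.mem_range.2 (Nat.lt_succ_of_le hkd)))
    exact Finset.single_le_sum (f := fun t => D k t) (fun _ _ => Nat.zero_le _)
      (Finset.mem_range.2 (by omega))
  · rw [map_substLast]
    exact hPa _ ha

theorem exists_totalDegree_le_of_nonsingularOverFp (m d : ℕ) (hm : 1 ≤ m) (hd : 2 ≤ d) :
    ∃ D : ℕ, ∀ (ℓ : ℕ) [Fact ℓ.Prime], d < ℓ → ∀ h g : MvPolynomial (Fin (m + 1)) ℤ,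
      g.totalDegree = d → NonsingularOverFp ℓ (redMod ℓ (LeadForm g)) →
      (∃ γ : ZMod ℓ, ∃ s : ℕ,
        (redMod ℓ h - C γ * redMod ℓ g).totalDegree < d ∧
        2 ≤ (redMod ℓ h - C γ * redMod ℓ g).totalDegree ∧
        SingLocusDimEq ℓ (LeadForm (redMod ℓ h - C γ * redMod ℓ g)) s) →
      ∃ P : MvPolynomial (Fin m) (AlgebraicClosure (ZMod ℓ)), P ≠ 0 ∧ P.totalDegree ≤ D ∧
        ∀ a : Fin m → ℤ, eval (fun i => (a i : AlgebraicClosure (ZMod ℓ))) P ≠ 0 →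
          NonsingularOverFp ℓ (SubstZero (lastRowMatrix a) (redMod ℓ (LeadForm g))) ∧
          ∀ (γ : ZMod ℓ) (s : ℕ),
            (redMod ℓ h - C γ * redMod ℓ g).totalDegree < d →
            2 ≤ (redMod ℓ h - C γ * redMod ℓ g).totalDegree →
            SingLocusDimEq ℓ (LeadForm (redMod ℓ h - C γ * redMod ℓ g)) s →
            2 ≤ (SubstZero (lastRowMatrix a)
              (LeadForm (redMod ℓ h - C γ * redMod ℓ g))).totalDegree ∧
            SingLocusDimLe ℓ (SubstZero (lastRowMatrix a)
              (LeadForm (redMod ℓ h - C γ * redMod ℓ g))) (max (s - 1) 0) := by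
  obtain ⟨D, hD⟩ := exists_totalDegree_le_of_singLocusDimLe m d
  refine ⟨D + D, fun ℓ _ hdℓ h g hg hG ⟨γ₀, s₀, hγ₀, hγ₀', hs₀⟩ => ?_⟩
  have hGhom : (redMod ℓ (LeadForm g)).IsHomogeneous d := hg ▸ (isHomogeneous_leadForm g).map _
  obtain ⟨P, hP, hPD, b, hPa⟩ := hD ℓ d 0 hd le_rfl hdℓ (Nat.zero_le m) _ hGhom hG.ne_zero
    (singLocusDimLe_of_singularOnlyAtZero hGhom hG.singularOnlyAtZero)
  set f := redMod ℓ h - C γ₀ * redMod ℓ g with hf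
  have hf0 : f ≠ 0 := by
    intro h0
    rw [h0, totalDegree_zero] at hγ₀'
    omega
  have hsm : s₀ ≤ m := le_of_singLocusDimEq (leadForm_ne_zero hf0) hs₀
  obtain ⟨Q, hQ, hQD, b', hQa⟩ := hD ℓ f.totalDegree s₀ hγ₀' hγ₀.le hdℓ hsm (LeadForm f)
    (isHomogeneous_leadForm f) (leadForm_ne_zero hf0) fun K _ _ hK hK' => (hs₀ K hK hK').le
  refine ⟨P * Q, mul_ne_zero hP hQ, (totalDegree_mul _ _).trans (add_le_add hPD hQD),
    fun a ha => ?_⟩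
  rw [map_mul, mul_ne_zero_iff] at ha
  have hP' := hPa (fun i => a i) (by simpa using ha.1)
  have hQ' := hQa (fun i => a i) (by simpa using ha.2)
  refine ⟨?_, fun γ s hγ hγ' hs => ?_⟩
  · rw [substZero_lastRowMatrix]
    exact nonsingularOverFp_of_singularOnlyAtZero hP'
  · obtain rfl := eq_of_totalDegree_sub_lt hg hG.ne_zero hγ hγ₀
    have hss : s = s₀ := by
      have h1 := (hs (AlgebraicClosure (ZMod ℓ)) inferInstance inferInstance).symm.trans
        (hs₀ (AlgebraicClosure (ZMod ℓ)) inferInstance inferInstance)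
      change (s : WithBot ℕ∞) = s₀ at h1
      exact_mod_cast h1
    subst hss
    have hhom := isHomogeneous_substLast (fun i => (a i : ZMod ℓ)) (isHomogeneous_leadForm f)
    rw [substZero_lastRowMatrix, Nat.max_zero]
    refine ⟨?_, singLocusDimLe_of_singularOnlyAtZero hhom hQ'⟩
    have hne : substLast (fun i => (a i : ZMod ℓ)) (LeadForm f) ≠ 0 := fun h0 =>
      hQ'.ne_zero (by omega) (by rw [h0, map_zero])
    change 2 ≤ (substLast (fun i => (a i : ZMod ℓ)) (LeadForm f)).totalDegree
    rwa [hhom.totalDegree hne]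

theorem injOn_natCast_range_algebraicClosure {ℓ N : ℕ} [Fact ℓ.Prime] (hN : N ≤ ℓ) :
    Set.InjOn (Nat.cast : ℕ → AlgebraicClosure (ZMod ℓ)) (Finset.range N) := by
  have : CharP (AlgebraicClosure (ZMod ℓ)) ℓ := charP_of_injective_algebraMap
    (algebraMap (ZMod ℓ) (AlgebraicClosure (ZMod ℓ))).injective ℓ
  refine (CharP.natCast_injOn_Iio (AlgebraicClosure (ZMod ℓ)) ℓ).mono fun i hi => ?_
  have := Finset.mem_range.1 hi
  exact Set.mem_Iio.2 (by omega)

theorem stmt12 (n d : ℕ) (hn : 2 ≤ n) (hd : 3 ≤ d) :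
    ∃ C : ℕ, ∀ (q p : ℕ),
      ((q.Prime ∧ p = q) ∨
        (p.Prime ∧ ∃ p₂ : ℕ, p₂.Prime ∧ p < p₂ ∧ p₂ < 2 * p ∧ q = p * p₂)) →
      (∀ ℓ : ℕ, ℓ.Prime → ℓ ∣ q → C < ℓ) →
      ∀ (h g : MvPolynomial (Fin n) ℤ),
        h.totalDegree ≤ g.totalDegree → g.totalDegree = d →
        ((∃ c : ℤ, LeadForm h = c • LeadForm g) ∨ h.totalDegree < d) →
        (∀ ℓ : ℕ, ℓ.Prime → ℓ ∣ q →
          NonsingularOverFp ℓ (redMod ℓ (LeadForm g)) ∧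
          ∃ γ : ZMod ℓ, ∃ s : ℕ,
            (redMod ℓ h - MvPolynomial.C γ * redMod ℓ g).totalDegree < d ∧
            2 ≤ (redMod ℓ h - MvPolynomial.C γ * redMod ℓ g).totalDegree ∧
            SingLocusDimEq ℓ (LeadForm (redMod ℓ h - MvPolynomial.C γ * redMod ℓ g)) s) →
        ∃ M : Matrix (Fin n) (Fin n) ℤ, M.det = 1 ∧ (∀ i j, |M i j| ≤ (C : ℤ)) ∧
          ∀ ℓ : ℕ, ℓ.Prime → ℓ ∣ q →
            -- (a) the restricted form `G_M(y₁,…,y_{n-1},0)` is nonsingular mod `ℓ`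
            NonsingularOverFp ℓ (SubstZero M (redMod ℓ (LeadForm g))) ∧
            -- (b) the restricted form `(H_ℓ)_M(y₁,…,y_{n-1},0)` has degree at least `2`
            -- and singular locus of dimension at most `max (s-1) 0`
            (∀ (γ : ZMod ℓ) (s : ℕ),
              (redMod ℓ h - MvPolynomial.C γ * redMod ℓ g).totalDegree < d →
              2 ≤ (redMod ℓ h - MvPolynomial.C γ * redMod ℓ g).totalDegree →
              SingLocusDimEq ℓ (LeadForm (redMod ℓ h - MvPolynomial.C γ * redMod ℓ g)) s →
              2 ≤ (SubstZero M
                (LeadForm (redMod ℓ h - MvPolynomial.C γ * redMod ℓ g))).totalDegree ∧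
              SingLocusDimLe ℓ (SubstZero M
                (LeadForm (redMod ℓ h - MvPolynomial.C γ * redMod ℓ g))) (max (s - 1) 0)) := by
  obtain ⟨m, rfl⟩ : ∃ m, n = m + 1 := ⟨n - 1, by omega⟩
  obtain ⟨D, hD⟩ := exists_totalDegree_le_of_nonsingularOverFp m d (by omega) (by omega)
  refine ⟨2 * D + 1 + d, fun q p hq hC h g _ hg _ hℓ => ?_⟩
  obtain ⟨p', hp, hp', hpq, hp'q, hqpp'⟩ : ∃ p' : ℕ, p.Prime ∧ p'.Prime ∧ p ∣ q ∧ p' ∣ q ∧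
      ∀ ℓ : ℕ, ℓ.Prime → ℓ ∣ q → ℓ = p ∨ ℓ = p' := by
    rcases hq with ⟨hq, rfl⟩ | ⟨hp, p₂, hp₂, -, -, rfl⟩
    · exact ⟨p, hq, hq, dvd_rfl, dvd_rfl,
        fun ℓ hℓ h => Or.inl ((Nat.prime_dvd_prime_iff_eq hℓ hq).1 h)⟩
    · refine ⟨p₂, hp, hp₂, dvd_mul_right _ _, dvd_mul_left _ _, fun ℓ hℓ h => ?_⟩
      exact (hℓ.dvd_mul.1 h).imp (Nat.prime_dvd_prime_iff_eq hℓ hp).1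
        (Nat.prime_dvd_prime_iff_eq hℓ hp₂).1
  have : Fact p.Prime := ⟨hp⟩
  have : Fact p'.Prime := ⟨hp'⟩
  have hpC := hC p hp hpq
  have hp'C := hC p' hp' hp'q
  obtain ⟨P, hP, hPD, hPa⟩ := hD p (by omega) h g hg (hℓ p hp hpq).1 (hℓ p hp hpq).2
  obtain ⟨Q, hQ, hQD, hQa⟩ := hD p' (by omega) h g hg (hℓ p' hp' hp'q).1 (hℓ p' hp' hp'q).2
  obtain ⟨a, ha, haP, haQ⟩ := exists_eval_ne_zero_and_eval_ne_zero (N := 2 * D + 1)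
    (injOn_natCast_range_algebraicClosure (by omega))
    (injOn_natCast_range_algebraicClosure (by omega)) hP (by omega) hQ (by omega)
  refine ⟨lastRowMatrix fun i => (a i : ℤ), det_lastRowMatrix _, abs_lastRowMatrix_le ?_ ?_, ?_⟩
  · push_cast
    omega
  · intro i
    rw [Nat.abs_cast]
    have := ha i
    exact_mod_cast (by omega : a i ≤ 2 * D + 1 + d)
  · intro ℓ hℓprime hℓq
    rcases hqpp' ℓ hℓprime hℓq with rfl | rfl
    · exact hPa (fun i => a i) (by simpa using haP)
    · exact hQa (fun i => a i) (by simpa using haQ)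
end
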